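/- Every SP graph over 𝔹 is the semantics of some A-term: for every SP graph G there exists a term a generated by the non-terminal A of the normal-form grammar such that ⟦a⟧ = {G}. In particular, every SP graph has a decomposition, unique up to associativity, into sequential and parallel compositions of single-edge graphs. -/

import Mathlib

/-!
Formalization of "Attack Trees with Sequential Conjunction".

Source-sink graphs over a set `B` of basic actions: a vertex type `V`,
a multiset of labeled edges, a source `s` and a sink `z` with `s ≠ z`.
-/

structure SSG (B : Type) : Type 1 where
  V : Type
  deq : DecidableEq V
  E : Multiset (V × B × V)
  s : V
  z : V
  ne : s ≠ z

namespace SSG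

variable {B : Type}

/-- The graph with a single edge labeled `b`. -/
def single (b : B) : SSG B where
  V := Bool
  deq := inferInstance
  E := {(false, b, true)}
  s := false
  z := true
  ne := Bool.false_ne_true

/-- In the sequential composition, the sink of the first graph is identified with
the source of the second graph. -/
def seqEmbed (G G' : SSG B) (v : G.V) : ({u : G.V // u ≠ G.z} ⊕ G'.V) :=
  haveI := G.deq
  if h : v = G.z then Sum.inr G'.s else Sum.inl ⟨v, h⟩

/-- Sequential composition `G ⋅ G'` of source-sink graphs: the disjoint union in which
the sink of `G` is identified with the source of `G'`. -/
def seq (G G' : SSG B) : SSG B where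
  V := {u : G.V // u ≠ G.z} ⊕ G'.V
  deq := by haveI := G.deq; haveI := G'.deq; infer_instance
  E := G.E.map (fun e => (G.seqEmbed G' e.1, e.2.1, G.seqEmbed G' e.2.2)) +
       G'.E.map (fun e => (Sum.inr e.1, e.2.1, Sum.inr e.2.2))
  s := Sum.inl ⟨G.s, G.ne⟩
  z := Sum.inr G'.z
  ne := by simp

/-- In the parallel composition, the two sources are identified and the two sinks
are identified. -/
def parEmbed (G G' : SSG B) (v : G.V) : ({u : G.V // u ≠ G.s ∧ u ≠ G.z} ⊕ G'.V) :=
  haveI := G.deq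
  if hs : v = G.s then Sum.inr G'.s
  else if hz : v = G.z then Sum.inr G'.z
  else Sum.inl ⟨v, hs, hz⟩

/-- Parallel composition `G ∥ G'` of source-sink graphs: the disjoint union in which
the two sources are identified and the two sinks are identified. -/
def par (G G' : SSG B) : SSG B where
  V := {u : G.V // u ≠ G.s ∧ u ≠ G.z} ⊕ G'.V
  deq := by haveI := G.deq; haveI := G'.deq; infer_instance
  E := G.E.map (fun e => (G.parEmbed G' e.1, e.2.1, G.parEmbed G' e.2.2)) +
       G'.E.map (fun e => (Sum.inr e.1, e.2.1, Sum.inr e.2.2))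
  s := Sum.inr G'.s
  z := Sum.inr G'.z
  ne := fun h => G'.ne (Sum.inr_injective h)

/-- Two source-sink graphs are equal (isomorphic) if there is a bijection between their
vertex sets that preserves the labeled edges (and hence source and sink). -/
def Iso (G G' : SSG B) : Prop :=
  ∃ f : G.V ≃ G'.V,
    G.E.map (fun e => (f e.1, e.2.1, f e.2.2)) = G'.E ∧ f G.s = G'.s ∧ f G.z = G'.z

/-- Directed adjacency: there is an edge from `u` to `v`. -/
def Adj (G : SSG B) (u v : G.V) : Prop := ∃ b, (u, b, v) ∈ G.E

/-- Series-parallel graphs (SP graphs): built from single edges by sequential and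
parallel composition; as SP graphs are considered up to isomorphism, the collection
is closed under isomorphism. -/
inductive IsSP : SSG B → Prop
  | single (b : B) : IsSP (single b)
  | seq {G G' : SSG B} : IsSP G → IsSP G' → IsSP (G.seq G')
  | par {G G' : SSG B} : IsSP G → IsSP G' → IsSP (G.par G')
  | iso {G G' : SSG B} : IsSP G → G.Iso G' → IsSP G'

/-- A graph is connected if any two vertices are joined by a path in the
underlying undirected graph. -/
def Connected (G : SSG B) : Prop :=
  ∀ u v : G.V, Relation.ReflTransGen (fun a b => G.Adj a b ∨ G.Adj b a) u v

/-- A directed graph is acyclic if it has no (nonempty) directed cycle. -/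
def Acyclic (G : SSG B) : Prop := ∀ v : G.V, ¬ Relation.TransGen G.Adj v v

end SSG
/-!
SAND attack trees: closed terms over `B ∪ {OR, AND, SAND}`, where the unranked
operators take `k ≥ 1` arguments (represented by nonempty lists `SandTreeList`).
-/

mutual
inductive SandTree (B : Type) : Type
  | atom : B → SandTree B
  | or : SandTreeList B → SandTree B
  | and : SandTreeList B → SandTree B
  | sand : SandTreeList B → SandTree B
inductive SandTreeList (B : Type) : Type
  | single : SandTree B → SandTreeList B
  | cons : SandTree B → SandTreeList B → SandTreeList B
end

namespace SandTreeList

variable {B : Type}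

def toList : SandTreeList B → List (SandTree B)
  | .single t => [t]
  | .cons t ts => t :: ts.toList

/-- Prepend a (possibly empty) list of trees to a nonempty argument list. -/
def glue : List (SandTree B) → SandTreeList B → SandTreeList B
  | [], ys => ys
  | x :: xs, ys => .cons x (glue xs ys)

/-- The nonempty argument list `t :: l`. -/
def ofList : SandTree B → List (SandTree B) → SandTreeList B
  | t, [] => .single t
  | t, u :: us => .cons t (ofList u us)

/-- Append a (possibly empty) list of trees to a nonempty argument list. -/
def snoc : SandTreeList B → List (SandTree B) → SandTreeList B
  | .single t, zs => ofList t zs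
  | .cons t ts, zs => .cons t (snoc ts zs)

def map (f : SandTree B → SandTree B) : SandTreeList B → SandTreeList B
  | .single t => .single (f t)
  | .cons t ts => .cons (f t) (map f ts)

end SandTreeList

/-!
The SP semantics `sem` interprets a SAND attack tree as a set of SP graphs
(sets of source-sink graphs closed under isomorphism, since SP graphs are
considered up to isomorphism):
`⟦b⟧ = {→b}`, `⟦OR(t₁,…,t_k)⟧ = ⋃ᵢ ⟦tᵢ⟧`,
`⟦AND(t₁,…,t_k)⟧ = {G₁ ∥ … ∥ G_k | Gᵢ ∈ ⟦tᵢ⟧}`,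
`⟦SAND(t₁,…,t_k)⟧ = {G₁ ⋅ … ⋅ G_k | Gᵢ ∈ ⟦tᵢ⟧}`.
-/

mutual
def sem {B : Type} : SandTree B → Set (SSG B)
  | .atom b => {G | (SSG.single b).Iso G}
  | .or ts => semOr ts
  | .and ts => semAnd ts
  | .sand ts => semSand ts
def semOr {B : Type} : SandTreeList B → Set (SSG B)
  | .single t => sem t
  | .cons t ts => sem t ∪ semOr ts
def semAnd {B : Type} : SandTreeList B → Set (SSG B)
  | .single t => sem t
  | .cons t ts => {G | ∃ G1 ∈ sem t, ∃ G2 ∈ semAnd ts, (G1.par G2).Iso G}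
def semSand {B : Type} : SandTreeList B → Set (SSG B)
  | .single t => sem t
  | .cons t ts => {G | ∃ G1 ∈ sem t, ∃ G2 ∈ semSand ts, (G1.seq G2).Iso G}
end
/-!
Equality of terms modulo commutativity of the unranked operators `OR` and `AND`
(the congruence generated by permuting the arguments of `OR` and `AND` nodes).
-/

mutual
inductive PEq {B : Type} : SandTree B → SandTree B → Prop
  | refl (t : SandTree B) : PEq t t
  | symm {t u : SandTree B} : PEq t u → PEq u t
  | trans {t u v : SandTree B} : PEq t u → PEq u v → PEq t v
  | orPerm {ts ts' : SandTreeList B} : ts.toList.Perm ts'.toList → PEq (.or ts) (.or ts')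
  | andPerm {ts ts' : SandTreeList B} : ts.toList.Perm ts'.toList → PEq (.and ts) (.and ts')
  | orCongr {ts ts' : SandTreeList B} : PEqL ts ts' → PEq (.or ts) (.or ts')
  | andCongr {ts ts' : SandTreeList B} : PEqL ts ts' → PEq (.and ts) (.and ts')
  | sandCongr {ts ts' : SandTreeList B} : PEqL ts ts' → PEq (.sand ts) (.sand ts')
inductive PEqL {B : Type} : SandTreeList B → SandTreeList B → Prop
  | single {t t' : SandTree B} : PEq t t' → PEqL (.single t) (.single t')
  | cons {t t' : SandTree B} {ts ts' : SandTreeList B} :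
      PEq t t' → PEqL ts ts' → PEqL (.cons t ts) (.cons t' ts')
end
/-!
Syntactic consequence from the axiom system `E_SP`.

The axiom schemes are represented by all of their instances (arbitrary argument
terms in place of the variable vectors `X⃗`, `Y⃗`, `Z⃗`); on closed terms this
generates exactly the same derivability relation as variables plus the
substitution rule.  Closure under "replacement in contexts" is represented by
the congruence rules for the three operators.
-/

section
open SandTreeList
mutual
inductive DerivSP {B : Type} : SandTree B → SandTree B → Prop
  /- closure rules -/
  | refl (t : SandTree B) : DerivSP t t
  | symm {t u : SandTree B} : DerivSP t u → DerivSP u t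
  | trans {t u v : SandTree B} : DerivSP t u → DerivSP u v → DerivSP t v
  | congrOr {ts ts' : SandTreeList B} : DerivSPL ts ts' → DerivSP (.or ts) (.or ts')
  | congrAnd {ts ts' : SandTreeList B} : DerivSPL ts ts' → DerivSP (.and ts) (.and ts')
  | congrSand {ts ts' : SandTreeList B} : DerivSPL ts ts' → DerivSP (.sand ts) (.sand ts')
  /- (E1) commutativity of OR -/
  | ax1 {ts ts' : SandTreeList B} : ts.toList.Perm ts'.toList → DerivSP (.or ts) (.or ts')
  /- (E2) commutativity of AND -/
  | ax2 {ts ts' : SandTreeList B} : ts.toList.Perm ts'.toList → DerivSP (.and ts) (.and ts')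
  /- (E3) OR(X⃗, OR(Y⃗)) = OR(X⃗, Y⃗) -/
  | ax3 (xs : List (SandTree B)) (ys : SandTreeList B) :
      DerivSP (.or (glue xs (.single (.or ys)))) (.or (glue xs ys))
  /- (E4) AND(X⃗, AND(Y⃗)) = AND(X⃗, Y⃗) -/
  | ax4 (xs : List (SandTree B)) (ys : SandTreeList B) :
      DerivSP (.and (glue xs (.single (.and ys)))) (.and (glue xs ys))
  /- (E4') SAND(X⃗, SAND(Y⃗), Z⃗) = SAND(X⃗, Y⃗, Z⃗) -/
  | ax4' (xs : List (SandTree B)) (ys : SandTreeList B) (zs : List (SandTree B)) :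
      DerivSP (.sand (glue xs (snoc (.single (.sand ys)) zs))) (.sand (glue xs (snoc ys zs)))
  /- (E5) OR(A) = A -/
  | ax5 (t : SandTree B) : DerivSP (.or (.single t)) t
  /- (E6) AND(A) = A -/
  | ax6 (t : SandTree B) : DerivSP (.and (.single t)) t
  /- (E6') SAND(A) = A -/
  | ax6' (t : SandTree B) : DerivSP (.sand (.single t)) t
  /- (E10) AND(X⃗, OR(Y⃗)) = OR(AND(X⃗,Y₁),…,AND(X⃗,Yₗ)) -/
  | ax10 (xs : List (SandTree B)) (ys : SandTreeList B) :
      DerivSP (.and (glue xs (.single (.or ys))))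
        (.or (SandTreeList.map (fun y => .and (glue xs (.single y))) ys))
  /- (E10') SAND(X⃗, OR(Y⃗), Z⃗) = OR(SAND(X⃗,Y₁,Z⃗),…,SAND(X⃗,Yₗ,Z⃗)) -/
  | ax10' (xs : List (SandTree B)) (ys : SandTreeList B) (zs : List (SandTree B)) :
      DerivSP (.sand (glue xs (snoc (.single (.or ys)) zs)))
        (.or (SandTreeList.map (fun y => .sand (glue xs (snoc (.single y) zs))) ys))
  /- (E11) OR(A, A, X⃗) = OR(A, X⃗) -/
  | ax11 (a : SandTree B) (xs : List (SandTree B)) :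
      DerivSP (.or (.cons a (ofList a xs))) (.or (ofList a xs))
inductive DerivSPL {B : Type} : SandTreeList B → SandTreeList B → Prop
  | single {t t' : SandTree B} : DerivSP t t' → DerivSPL (.single t) (.single t')
  | cons {t t' : SandTree B} {ts ts' : SandTreeList B} :
      DerivSP t t' → DerivSPL ts ts' → DerivSPL (.cons t ts) (.cons t' ts')
end
end

/-! Syntactic consequence from the SAND-free fragment
`E_SM = {E1, E2, E3, E4, E5, E6, E10, E11}` of `E_SP` (formulated over the full
signature of SAND attack trees). -/
section
open SandTreeList
mutual
inductive DerivSM {B : Type} : SandTree B → SandTree B → Prop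
  | refl (t : SandTree B) : DerivSM t t
  | symm {t u : SandTree B} : DerivSM t u → DerivSM u t
  | trans {t u v : SandTree B} : DerivSM t u → DerivSM u v → DerivSM t v
  | congrOr {ts ts' : SandTreeList B} : DerivSML ts ts' → DerivSM (.or ts) (.or ts')
  | congrAnd {ts ts' : SandTreeList B} : DerivSML ts ts' → DerivSM (.and ts) (.and ts')
  | congrSand {ts ts' : SandTreeList B} : DerivSML ts ts' → DerivSM (.sand ts) (.sand ts')
  | ax1 {ts ts' : SandTreeList B} : ts.toList.Perm ts'.toList → DerivSM (.or ts) (.or ts')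
  | ax2 {ts ts' : SandTreeList B} : ts.toList.Perm ts'.toList → DerivSM (.and ts) (.and ts')
  | ax3 (xs : List (SandTree B)) (ys : SandTreeList B) :
      DerivSM (.or (glue xs (.single (.or ys)))) (.or (glue xs ys))
  | ax4 (xs : List (SandTree B)) (ys : SandTreeList B) :
      DerivSM (.and (glue xs (.single (.and ys)))) (.and (glue xs ys))
  | ax5 (t : SandTree B) : DerivSM (.or (.single t)) t
  | ax6 (t : SandTree B) : DerivSM (.and (.single t)) t
  | ax10 (xs : List (SandTree B)) (ys : SandTreeList B) :
      DerivSM (.and (glue xs (.single (.or ys))))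
        (.or (SandTreeList.map (fun y => .and (glue xs (.single y))) ys))
  | ax11 (a : SandTree B) (xs : List (SandTree B)) :
      DerivSM (.or (.cons a (ofList a xs))) (.or (ofList a xs))
inductive DerivSML {B : Type} : SandTreeList B → SandTreeList B → Prop
  | single {t t' : SandTree B} : DerivSM t t' → DerivSML (.single t) (.single t')
  | cons {t t' : SandTree B} {ts ts' : SandTreeList B} :
      DerivSM t t' → DerivSML ts ts' → DerivSML (.cons t ts) (.cons t' ts')
end
end
/-!
The normal-form grammar (for `k ≥ 2`, `b ∈ B`):
`N ::= A | OR(A₁,…,A_k)` (with pairwise distinct `Aᵢ`),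
`A ::= C | S`, `C ::= b | AND(S₁,…,S_k)`, `S ::= b | SAND(C₁,…,C_k)`.
-/

mutual
inductive IsC {B : Type} : SandTree B → Prop
  | atom (b : B) : IsC (.atom b)
  | and {ts : SandTreeList B} : 2 ≤ ts.toList.length → IsSL ts → IsC (.and ts)
inductive IsS {B : Type} : SandTree B → Prop
  | atom (b : B) : IsS (.atom b)
  | sand {ts : SandTreeList B} : 2 ≤ ts.toList.length → IsCL ts → IsS (.sand ts)
inductive IsSL {B : Type} : SandTreeList B → Prop
  | single {t : SandTree B} : IsS t → IsSL (.single t)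
  | cons {t : SandTree B} {ts : SandTreeList B} : IsS t → IsSL ts → IsSL (.cons t ts)
inductive IsCL {B : Type} : SandTreeList B → Prop
  | single {t : SandTree B} : IsC t → IsCL (.single t)
  | cons {t : SandTree B} {ts : SandTreeList B} : IsC t → IsCL ts → IsCL (.cons t ts)
end

/-- Terms generated by the non-terminal `A` of the normal-form grammar. -/
def IsA {B : Type} (t : SandTree B) : Prop := IsC t ∨ IsS t

/-- Terms generated by the non-terminal `N` of the normal-form grammar; as terms
are considered modulo commutativity of `OR` and `AND`, the arguments of the `OR`
are required to be pairwise distinct modulo commutativity. -/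
def IsN {B : Type} (t : SandTree B) : Prop :=
  IsA t ∨ ∃ ts : SandTreeList B, t = .or ts ∧ 2 ≤ ts.toList.length ∧
    (∀ u ∈ ts.toList, IsA u) ∧ ts.toList.Pairwise (fun a b => ¬ PEq a b)

/-!
The term rewriting system obtained by orienting the axioms
(E3), (E4), (E4'), (E5), (E6), (E6'), (E10), (E10'), (E11) from left to right,
applied in any context, modulo commutativity of `OR` and `AND`.
-/

section
open SandTreeList

/-- Rule application at the root. -/
inductive RStep {B : Type} : SandTree B → SandTree B → Prop
  | r3 (xs : List (SandTree B)) (ys : SandTreeList B) :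
      RStep (.or (glue xs (.single (.or ys)))) (.or (glue xs ys))
  | r4 (xs : List (SandTree B)) (ys : SandTreeList B) :
      RStep (.and (glue xs (.single (.and ys)))) (.and (glue xs ys))
  | r4' (xs : List (SandTree B)) (ys : SandTreeList B) (zs : List (SandTree B)) :
      RStep (.sand (glue xs (snoc (.single (.sand ys)) zs))) (.sand (glue xs (snoc ys zs)))
  | r5 (t : SandTree B) : RStep (.or (.single t)) t
  | r6 (t : SandTree B) : RStep (.and (.single t)) t
  | r6' (t : SandTree B) : RStep (.sand (.single t)) t
  | r10 (xs : List (SandTree B)) (ys : SandTreeList B) :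
      RStep (.and (glue xs (.single (.or ys))))
        (.or (SandTreeList.map (fun y => .and (glue xs (.single y))) ys))
  | r10' (xs : List (SandTree B)) (ys : SandTreeList B) (zs : List (SandTree B)) :
      RStep (.sand (glue xs (snoc (.single (.or ys)) zs)))
        (.or (SandTreeList.map (fun y => .sand (glue xs (snoc (.single y) zs))) ys))
  | r11 (a : SandTree B) (xs : List (SandTree B)) :
      RStep (.or (.cons a (ofList a xs))) (.or (ofList a xs))

end

/-! Rule application in an arbitrary context. -/
mutual
inductive Rw {B : Type} : SandTree B → SandTree B → Prop
  | root {t t' : SandTree B} : RStep t t' → Rw t t'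
  | or {ts ts' : SandTreeList B} : RwL ts ts' → Rw (.or ts) (.or ts')
  | and {ts ts' : SandTreeList B} : RwL ts ts' → Rw (.and ts) (.and ts')
  | sand {ts ts' : SandTreeList B} : RwL ts ts' → Rw (.sand ts) (.sand ts')
inductive RwL {B : Type} : SandTreeList B → SandTreeList B → Prop
  | single {t t' : SandTree B} : Rw t t' → RwL (.single t) (.single t')
  | head {t t' : SandTree B} {ts : SandTreeList B} : Rw t t' → RwL (.cons t ts) (.cons t' ts)
  | tail {t : SandTree B} {ts ts' : SandTreeList B} : RwL ts ts' → RwL (.cons t ts) (.cons t ts')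
end

/-- One rewrite step of the TRS `⇒`, working modulo commutativity of `OR` and `AND`. -/
def RwMod {B : Type} (t t' : SandTree B) : Prop :=
  ∃ u u' : SandTree B, PEq t u ∧ Rw u u' ∧ PEq u' t'

/-- Zero or more rewrite steps (modulo commutativity of `OR` and `AND`). -/
def RwStar {B : Type} : SandTree B → SandTree B → Prop :=
  Relation.ReflTransGen (fun a b => PEq a b ∨ Rw a b)

/-- A normal form: no rewrite rule is applicable, modulo commutativity of `OR` and `AND`. -/
def NormalForm {B : Type} (t : SandTree B) : Prop :=
  ∀ u t' : SandTree B, PEq t u → ¬ Rw u t'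

/-! The norm `‖·‖`: `‖b‖ = 1`, `‖OR(t₁,…,t_k)‖ = ‖t₁‖+…+‖t_k‖+2`,
`‖AND(t₁,…,t_k)‖ = ‖SAND(t₁,…,t_k)‖ = 2·‖t₁‖·…·‖t_k‖`. -/
mutual
def weight {B : Type} : SandTree B → ℕ
  | .atom _ => 1
  | .or ts => weightSum ts + 2
  | .and ts => 2 * weightProd ts
  | .sand ts => 2 * weightProd ts
def weightSum {B : Type} : SandTreeList B → ℕ
  | .single t => weight t
  | .cons t ts => weight t + weightSum ts
def weightProd {B : Type} : SandTreeList B → ℕ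
  | .single t => weight t
  | .cons t ts => weight t * weightProd ts
end
/-!
Standard attack trees are SAND attack trees containing no `SAND` operator.
The multiset semantics maps a standard attack tree to a set of finite multisets
over `B`: `⟦b⟧_M = {⟨b⟩}`, `⟦OR⟧_M = ⋃ᵢ ⟦tᵢ⟧_M`,
`⟦AND⟧_M = {M₁ ⊎ … ⊎ M_k | Mᵢ ∈ ⟦tᵢ⟧_M}`.
(Its value on trees containing `SAND` is irrelevant and set to `∅`.)
-/

mutual
inductive NoSand {B : Type} : SandTree B → Prop
  | atom (b : B) : NoSand (.atom b)
  | or {ts : SandTreeList B} : NoSandL ts → NoSand (.or ts)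
  | and {ts : SandTreeList B} : NoSandL ts → NoSand (.and ts)
inductive NoSandL {B : Type} : SandTreeList B → Prop
  | single {t : SandTree B} : NoSand t → NoSandL (.single t)
  | cons {t : SandTree B} {ts : SandTreeList B} : NoSand t → NoSandL ts → NoSandL (.cons t ts)
end

mutual
def msem {B : Type} : SandTree B → Set (Multiset B)
  | .atom b => {({b} : Multiset B)}
  | .or ts => msemOr ts
  | .and ts => msemAnd ts
  | .sand _ => ∅
def msemOr {B : Type} : SandTreeList B → Set (Multiset B)
  | .single t => msem t
  | .cons t ts => msem t ∪ msemOr ts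
def msemAnd {B : Type} : SandTreeList B → Set (Multiset B)
  | .single t => msem t
  | .cons t ts => {M | ∃ M1 ∈ msem t, ∃ M2 ∈ msemAnd ts, M = M1 + M2}
end

/-- Parallel composition of a nonempty list of graphs `G ∥ H₁ ∥ … ∥ H_k`. -/
def parAll {B : Type} : SSG B → List (SSG B) → SSG B
  | G, [] => G
  | G, H :: Hs => parAll (G.par H) Hs

/-- SAND attack trees modulo equivalence with respect to the SP semantics
(`t ~ t'` iff `⟦t⟧ = ⟦t'⟧`). -/
def semSetoid (B : Type) : Setoid (SandTree B) :=
  ⟨fun t t' => sem t = sem t', fun _ => rfl, Eq.symm, Eq.trans⟩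

/-- The map induced by the SP semantics on equivalence classes of SAND attack trees. -/
def semClass {B : Type} : Quotient (semSetoid B) → Set (SSG B) :=
  Quotient.lift sem (fun _ _ h => h)

/-!
Bottom-up evaluation of the minimal attack time attribute on SAND attack trees:
`α(b) = β(b)`, `α(OR) = min`, `α(AND) = max`, `α(SAND) = Σ`.
-/

mutual
def attr {B : Type} (β : B → NNReal) : SandTree B → NNReal
  | .atom b => β b
  | .or ts => attrOr β ts
  | .and ts => attrAnd β ts
  | .sand ts => attrSand β ts
def attrOr {B : Type} (β : B → NNReal) : SandTreeList B → NNReal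
  | .single t => attr β t
  | .cons t ts => min (attr β t) (attrOr β ts)
def attrAnd {B : Type} (β : B → NNReal) : SandTreeList B → NNReal
  | .single t => attr β t
  | .cons t ts => max (attr β t) (attrAnd β ts)
def attrSand {B : Type} (β : B → NNReal) : SandTreeList B → NNReal
  | .single t => attr β t
  | .cons t ts => attr β t + attrSand β ts
end
/-!
Standard attack trees as a standalone signature (`B ∪ {OR, AND}`, unranked
operators with `k ≥ 1` arguments), their multiset semantics, and syntactic
consequence from the axiom system `E_SM`.
-/

mutual
inductive ATree (B : Type) : Type
  | atom : B → ATree B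
  | or : ATreeList B → ATree B
  | and : ATreeList B → ATree B
inductive ATreeList (B : Type) : Type
  | single : ATree B → ATreeList B
  | cons : ATree B → ATreeList B → ATreeList B
end

namespace ATreeList

variable {B : Type}

def toList : ATreeList B → List (ATree B)
  | .single t => [t]
  | .cons t ts => t :: ts.toList

def glue : List (ATree B) → ATreeList B → ATreeList B
  | [], ys => ys
  | x :: xs, ys => .cons x (glue xs ys)

def ofList : ATree B → List (ATree B) → ATreeList B
  | t, [] => .single t
  | t, u :: us => .cons t (ofList u us)

def map (f : ATree B → ATree B) : ATreeList B → ATreeList B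
  | .single t => .single (f t)
  | .cons t ts => .cons (f t) (map f ts)

end ATreeList

/-! The multiset semantics of standard attack trees. -/

mutual
def amsem {B : Type} : ATree B → Set (Multiset B)
  | .atom b => {({b} : Multiset B)}
  | .or ts => amsemOr ts
  | .and ts => amsemAnd ts
def amsemOr {B : Type} : ATreeList B → Set (Multiset B)
  | .single t => amsem t
  | .cons t ts => amsem t ∪ amsemOr ts
def amsemAnd {B : Type} : ATreeList B → Set (Multiset B)
  | .single t => amsem t
  | .cons t ts => {M | ∃ M1 ∈ amsem t, ∃ M2 ∈ amsemAnd ts, M = M1 + M2}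
end

/-!
Syntactic consequence from `E_SM = {E1, E2, E3, E4, E5, E6, E10, E11}`.
Axiom schemes are represented by all of their instances (closure under
substitution is then automatic), and closure under replacement in contexts is
represented by the congruence rules.
-/

section
open ATreeList
mutual
inductive DerivASM {B : Type} : ATree B → ATree B → Prop
  | refl (t : ATree B) : DerivASM t t
  | symm {t u : ATree B} : DerivASM t u → DerivASM u t
  | trans {t u v : ATree B} : DerivASM t u → DerivASM u v → DerivASM t v
  | congrOr {ts ts' : ATreeList B} : DerivASML ts ts' → DerivASM (.or ts) (.or ts')
  | congrAnd {ts ts' : ATreeList B} : DerivASML ts ts' → DerivASM (.and ts) (.and ts')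
  /- (E1) -/
  | ax1 {ts ts' : ATreeList B} : ts.toList.Perm ts'.toList → DerivASM (.or ts) (.or ts')
  /- (E2) -/
  | ax2 {ts ts' : ATreeList B} : ts.toList.Perm ts'.toList → DerivASM (.and ts) (.and ts')
  /- (E3) -/
  | ax3 (xs : List (ATree B)) (ys : ATreeList B) :
      DerivASM (.or (glue xs (.single (.or ys)))) (.or (glue xs ys))
  /- (E4) -/
  | ax4 (xs : List (ATree B)) (ys : ATreeList B) :
      DerivASM (.and (glue xs (.single (.and ys)))) (.and (glue xs ys))
  /- (E5) -/
  | ax5 (t : ATree B) : DerivASM (.or (.single t)) t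
  /- (E6) -/
  | ax6 (t : ATree B) : DerivASM (.and (.single t)) t
  /- (E10) -/
  | ax10 (xs : List (ATree B)) (ys : ATreeList B) :
      DerivASM (.and (glue xs (.single (.or ys))))
        (.or (ATreeList.map (fun y => .and (glue xs (.single y))) ys))
  /- (E11) -/
  | ax11 (a : ATree B) (xs : List (ATree B)) :
      DerivASM (.or (.cons a (ofList a xs))) (.or (ofList a xs))
inductive DerivASML {B : Type} : ATreeList B → ATreeList B → Prop
  | single {t t' : ATree B} : DerivASM t t' → DerivASML (.single t) (.single t')
  | cons {t t' : ATree B} {ts ts' : ATreeList B} :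
      DerivASM t t' → DerivASML ts ts' → DerivASML (.cons t ts) (.cons t' ts')
end
end

/-!
Labeled relational structures realizing a SAND attack tree: `Realizes r lab t S` states that the
subset `S` of a set of labeled events with precedence relation `r` is one of the series-parallel
structures described by `t`.
-/

section Order

variable {B X : Type}

/-- `S₁` and `S₂` are disjoint and unrelated by `r`. -/
def ParRel (r : X → X → Prop) (S₁ S₂ : Set X) : Prop :=
  Disjoint S₁ S₂ ∧ ∀ x ∈ S₁, ∀ y ∈ S₂, ¬ r x y ∧ ¬ r y x

/-- `S₁` and `S₂` are disjoint and `S₁` strictly precedes `S₂`. -/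
def SeqRel (r : X → X → Prop) (S₁ S₂ : Set X) : Prop :=
  Disjoint S₁ S₂ ∧ ∀ x ∈ S₁, ∀ y ∈ S₂, r x y ∧ ¬ r y x

mutual
def Realizes (r : X → X → Prop) (lab : X → B) : SandTree B → Set X → Prop
  | .atom b, S => ∃ x, lab x = b ∧ S = {x}
  | .or ts, S => RealizesOr r lab ts S
  | .and ts, S => RealizesAnd r lab ts S
  | .sand ts, S => RealizesSand r lab ts S
def RealizesOr (r : X → X → Prop) (lab : X → B) : SandTreeList B → Set X → Prop
  | .single t, S => Realizes r lab t S
  | .cons t ts, S => Realizes r lab t S ∨ RealizesOr r lab ts S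
def RealizesAnd (r : X → X → Prop) (lab : X → B) : SandTreeList B → Set X → Prop
  | .single t, S => Realizes r lab t S
  | .cons t ts, S =>
    ∃ S₁ S₂, S = S₁ ∪ S₂ ∧ ParRel r S₁ S₂ ∧ Realizes r lab t S₁ ∧ RealizesAnd r lab ts S₂
def RealizesSand (r : X → X → Prop) (lab : X → B) : SandTreeList B → Set X → Prop
  | .single t, S => Realizes r lab t S
  | .cons t ts, S =>
    ∃ S₁ S₂, S = S₁ ∪ S₂ ∧ SeqRel r S₁ S₂ ∧ Realizes r lab t S₁ ∧ RealizesSand r lab ts S₂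
end

variable {r : X → X → Prop} {lab : X → B}

mutual
theorem Realizes.nonempty : ∀ {t : SandTree B} {S : Set X}, Realizes r lab t S → S.Nonempty
  | .atom b, S, h => by
    obtain ⟨x, -, rfl⟩ := h
    exact Set.singleton_nonempty x
  | .or ts, S, h => RealizesOr.nonempty (ts := ts) h
  | .and ts, S, h => RealizesAnd.nonempty (ts := ts) h
  | .sand ts, S, h => RealizesSand.nonempty (ts := ts) h
theorem RealizesOr.nonempty :
    ∀ {ts : SandTreeList B} {S : Set X}, RealizesOr r lab ts S → S.Nonempty
  | .single t, _, h => Realizes.nonempty (t := t) h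
  | .cons t ts, _, h => h.elim (Realizes.nonempty (t := t)) (RealizesOr.nonempty (ts := ts))
theorem RealizesAnd.nonempty :
    ∀ {ts : SandTreeList B} {S : Set X}, RealizesAnd r lab ts S → S.Nonempty
  | .single t, _, h => Realizes.nonempty (t := t) h
  | .cons t ts, S, h => by
    obtain ⟨S₁, S₂, rfl, -, h₁, -⟩ := h
    exact (Realizes.nonempty (t := t) h₁).inl
theorem RealizesSand.nonempty :
    ∀ {ts : SandTreeList B} {S : Set X}, RealizesSand r lab ts S → S.Nonempty
  | .single t, _, h => Realizes.nonempty (t := t) h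
  | .cons t ts, S, h => by
    obtain ⟨S₁, S₂, rfl, -, h₁, -⟩ := h
    exact (Realizes.nonempty (t := t) h₁).inl
end

section Transport

variable {Y : Type} {r' : Y → Y → Prop} {lab' : Y → B} {f : X → Y}

theorem ParRel.image (hf : f.Injective) (hr : ∀ x y, r' (f x) (f y) ↔ r x y) {S₁ S₂ : Set X}
    (h : ParRel r S₁ S₂) : ParRel r' (f '' S₁) (f '' S₂) := by
  refine ⟨(Set.disjoint_image_iff hf).2 h.1, ?_⟩
  rintro _ ⟨x, hx, rfl⟩ _ ⟨y, hy, rfl⟩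
  simpa [hr] using h.2 x hx y hy

theorem SeqRel.image (hf : f.Injective) (hr : ∀ x y, r' (f x) (f y) ↔ r x y) {S₁ S₂ : Set X}
    (h : SeqRel r S₁ S₂) : SeqRel r' (f '' S₁) (f '' S₂) := by
  refine ⟨(Set.disjoint_image_iff hf).2 h.1, ?_⟩
  rintro _ ⟨x, hx, rfl⟩ _ ⟨y, hy, rfl⟩
  simpa [hr] using h.2 x hx y hy

mutual
theorem Realizes.image (hf : f.Injective) (hr : ∀ x y, r' (f x) (f y) ↔ r x y)
    (hlab : ∀ x, lab' (f x) = lab x) :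
    ∀ (t : SandTree B) {S : Set X}, Realizes r lab t S → Realizes r' lab' t (f '' S)
  | .atom b, S, h => by
    obtain ⟨x, rfl, rfl⟩ := h
    exact ⟨f x, hlab x, Set.image_singleton⟩
  | .or ts, S, h => RealizesOr.image hf hr hlab ts h
  | .and ts, S, h => RealizesAnd.image hf hr hlab ts h
  | .sand ts, S, h => RealizesSand.image hf hr hlab ts h
theorem RealizesOr.image (hf : f.Injective) (hr : ∀ x y, r' (f x) (f y) ↔ r x y)
    (hlab : ∀ x, lab' (f x) = lab x) :
    ∀ (ts : SandTreeList B) {S : Set X}, RealizesOr r lab ts S → RealizesOr r' lab' ts (f '' S)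
  | .single t, _, h => Realizes.image hf hr hlab t h
  | .cons t ts, _, h => h.imp (Realizes.image hf hr hlab t) (RealizesOr.image hf hr hlab ts)
theorem RealizesAnd.image (hf : f.Injective) (hr : ∀ x y, r' (f x) (f y) ↔ r x y)
    (hlab : ∀ x, lab' (f x) = lab x) :
    ∀ (ts : SandTreeList B) {S : Set X}, RealizesAnd r lab ts S → RealizesAnd r' lab' ts (f '' S)
  | .single t, _, h => Realizes.image hf hr hlab t h
  | .cons t ts, S, h => by
    obtain ⟨S₁, S₂, rfl, h, h₁, h₂⟩ := h
    exact ⟨_, _, Set.image_union f S₁ S₂, h.image hf hr, Realizes.image hf hr hlab t h₁,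
      RealizesAnd.image hf hr hlab ts h₂⟩
theorem RealizesSand.image (hf : f.Injective) (hr : ∀ x y, r' (f x) (f y) ↔ r x y)
    (hlab : ∀ x, lab' (f x) = lab x) :
    ∀ (ts : SandTreeList B) {S : Set X}, RealizesSand r lab ts S → RealizesSand r' lab' ts (f '' S)
  | .single t, _, h => Realizes.image hf hr hlab t h
  | .cons t ts, S, h => by
    obtain ⟨S₁, S₂, rfl, h, h₁, h₂⟩ := h
    exact ⟨_, _, Set.image_union f S₁ S₂, h.image hf hr, Realizes.image hf hr hlab t h₁,
      RealizesSand.image hf hr hlab ts h₂⟩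
end

end Transport

/-- `S` is nonempty, and no proper nonempty subset of `S` is closed under `q` in `S`. -/
def Linked (q : X → X → Prop) (S : Set X) : Prop :=
  S.Nonempty ∧ ∀ T : Set X, (∀ x ∈ S, ∀ y ∈ S, q x y → x ∈ T → y ∈ T) →
    ∀ x ∈ S, ∀ y ∈ S, x ∈ T → y ∈ T

theorem linked_singleton (q : X → X → Prop) (x : X) : Linked q {x} := by
  refine ⟨Set.singleton_nonempty x, ?_⟩
  rintro T - y rfl z rfl h
  exact h

theorem linked_union {q : X → X → Prop} {S₁ S₂ : Set X} (h₁ : S₁.Nonempty) (h₂ : S₂.Nonempty)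
    (h : ∀ x ∈ S₁, ∀ y ∈ S₂, q x y ∧ q y x) : Linked q (S₁ ∪ S₂) := by
  refine ⟨h₁.inl, fun T hT => ?_⟩
  obtain ⟨a, ha⟩ := h₁
  obtain ⟨b, hb⟩ := h₂
  have h₁₂ : ∀ x ∈ S₁, ∀ y ∈ S₂, x ∈ T → y ∈ T := fun x hx y hy =>
    hT x (.inl hx) y (.inr hy) (h x hx y hy).1
  have h₂₁ : ∀ x ∈ S₁, ∀ y ∈ S₂, y ∈ T → x ∈ T := fun x hx y hy =>
    hT y (.inr hy) x (.inl hx) (h x hx y hy).2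
  rintro x (hx | hx) y (hy | hy) hxT
  · exact h₂₁ y hy b hb (h₁₂ x hx b hb hxT)
  · exact h₁₂ x hx y hy hxT
  · exact h₂₁ y hy x hx hxT
  · exact h₁₂ a ha y hy (h₂₁ a ha x hx hxT)

theorem not_linked_union {q : X → X → Prop} {S₁ S₂ : Set X} (h₁ : S₁.Nonempty)
    (h₂ : S₂.Nonempty) (hd : Disjoint S₁ S₂) (h : ∀ x ∈ S₁, ∀ y ∈ S₂, ¬ q x y) :
    ¬ Linked q (S₁ ∪ S₂) := by
  rintro ⟨-, hl⟩
  obtain ⟨a, ha⟩ := h₁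
  obtain ⟨b, hb⟩ := h₂
  refine Set.disjoint_left.1 hd (hl S₁ ?_ a (.inl ha) b (.inr hb) ha) hb
  rintro x - y (hy | hy) hq hx
  · exact hy
  · exact (h x hx y hy hq).elim

/-- `S₁` and `S₂` are disjoint and unrelated by `q` in both directions. -/
def Unlinked (q : X → X → Prop) (S₁ S₂ : Set X) : Prop :=
  Disjoint S₁ S₂ ∧ ∀ x ∈ S₁, ∀ y ∈ S₂, ¬ q x y ∧ ¬ q y x

instance (q : X → X → Prop) : Std.Symm (Unlinked q) :=
  ⟨fun _ _ h => ⟨h.1.symm, fun x hx y hy => (h.2 y hy x hx).symm⟩⟩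

theorem exists_superset_of_linked {q : X → X → Prop} {Ss : List (Set X)} {A S : Set X}
    (hA : Linked q A) (hAS : A ⊆ S) (hS : ∀ x, x ∈ S ↔ ∃ A ∈ Ss, x ∈ A)
    (hp : Ss.Pairwise (Unlinked q)) : ∃ A' ∈ Ss, A ⊆ A' := by
  obtain ⟨⟨a, ha⟩, hl⟩ := hA
  obtain ⟨A', hA', haA'⟩ := (hS a).1 (hAS ha)
  refine ⟨A', hA', fun b hb => hl A' ?_ a ha b hb haA'⟩
  intro x hx y hy hq hxA'
  obtain ⟨C, hC, hyC⟩ := (hS y).1 (hAS hy)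
  by_cases hne : A' = C
  · exact hne ▸ hyC
  · exact absurd hq ((hp.forall hA' hC hne).2 x hxA' y hyC).1

theorem subset_of_blocks {q : X → X → Prop} {Ss Ss' : List (Set X)} {S : Set X}
    (hS : ∀ x, x ∈ S ↔ ∃ A ∈ Ss, x ∈ A) (hS' : ∀ x, x ∈ S ↔ ∃ A ∈ Ss', x ∈ A)
    (hp : Ss.Pairwise (Unlinked q)) (hp' : Ss'.Pairwise (Unlinked q))
    (hl : ∀ A ∈ Ss, Linked q A) (hl' : ∀ A ∈ Ss', Linked q A) : Ss ⊆ Ss' := by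
  intro A hA
  obtain ⟨A', hA', h⟩ := exists_superset_of_linked (hl A hA) (fun x hx => (hS x).2 ⟨A, hA, hx⟩)
    hS' hp'
  obtain ⟨C, hC, h'⟩ := exists_superset_of_linked (hl' A' hA')
    (fun x hx => (hS' x).2 ⟨A', hA', hx⟩) hS hp
  obtain ⟨a, ha⟩ := (hl A hA).1
  have hAC : A = C := by
    by_contra hne
    exact Set.disjoint_left.1 (hp.forall hA hC hne).1 ha (h' (h ha))
  rwa [h.antisymm (hAC ▸ h')]

theorem nodup_of_blocks {q : X → X → Prop} {Ss : List (Set X)} (hp : Ss.Pairwise (Unlinked q))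
    (hl : ∀ A ∈ Ss, Linked q A) : Ss.Nodup := by
  refine hp.imp_of_mem ?_
  rintro A C hA - h rfl
  obtain ⟨a, ha⟩ := (hl A hA).1
  exact Set.disjoint_left.1 h.1 ha ha

/-- A set has at most one partition into `q`-connected blocks unrelated by `q`. -/
theorem perm_of_blocks {q : X → X → Prop} {Ss Ss' : List (Set X)} {S : Set X}
    (hS : ∀ x, x ∈ S ↔ ∃ A ∈ Ss, x ∈ A) (hS' : ∀ x, x ∈ S ↔ ∃ A ∈ Ss', x ∈ A)
    (hp : Ss.Pairwise (Unlinked q)) (hp' : Ss'.Pairwise (Unlinked q))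
    (hl : ∀ A ∈ Ss, Linked q A) (hl' : ∀ A ∈ Ss', Linked q A) : Ss.Perm Ss' :=
  (List.perm_ext_iff_of_nodup (nodup_of_blocks hp hl) (nodup_of_blocks hp' hl')).2 fun _ =>
    ⟨fun h => subset_of_blocks hS hS' hp hp' hl hl' h,
      fun h => subset_of_blocks hS' hS hp' hp hl' hl h⟩

theorem RealizesAnd.exists_blocks : ∀ {ts : SandTreeList B} {S : Set X}, RealizesAnd r lab ts S →
    ∃ Ss : List (Set X), List.Forall₂ (Realizes r lab) ts.toList Ss ∧ Ss.Pairwise (ParRel r) ∧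
      ∀ x, x ∈ S ↔ ∃ A ∈ Ss, x ∈ A
  | .single t, S, h => ⟨[S], .cons h .nil, List.pairwise_singleton _ _, by simp⟩
  | .cons t ts, S, h => by
    obtain ⟨S₁, S₂, rfl, h, h₁, h₂⟩ := h
    obtain ⟨Ss, hf, hp, hS⟩ := RealizesAnd.exists_blocks h₂
    refine ⟨S₁ :: Ss, .cons h₁ hf, List.pairwise_cons.2 ⟨fun A hA => ?_, hp⟩, by simp [hS]⟩
    have hA₂ : A ⊆ S₂ := fun x hx => (hS x).2 ⟨A, hA, hx⟩
    exact ⟨h.1.mono_right hA₂, fun x hx y hy => h.2 x hx y (hA₂ hy)⟩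

theorem RealizesSand.exists_blocks : ∀ {ts : SandTreeList B} {S : Set X}, RealizesSand r lab ts S →
    ∃ Ss : List (Set X), List.Forall₂ (Realizes r lab) ts.toList Ss ∧ Ss.Pairwise (SeqRel r) ∧
      ∀ x, x ∈ S ↔ ∃ A ∈ Ss, x ∈ A
  | .single t, S, h => ⟨[S], .cons h .nil, List.pairwise_singleton _ _, by simp⟩
  | .cons t ts, S, h => by
    obtain ⟨S₁, S₂, rfl, h, h₁, h₂⟩ := h
    obtain ⟨Ss, hf, hp, hS⟩ := RealizesSand.exists_blocks h₂
    refine ⟨S₁ :: Ss, .cons h₁ hf, List.pairwise_cons.2 ⟨fun A hA => ?_, hp⟩, by simp [hS]⟩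
    have hA₂ : A ⊆ S₂ := fun x hx => (hS x).2 ⟨A, hA, hx⟩
    exact ⟨h.1.mono_right hA₂, fun x hx y hy => h.2 x hx y (hA₂ hy)⟩

/-- Comparability with respect to `r`. -/
def Comp (r : X → X → Prop) (x y : X) : Prop := r x y ∨ r y x

/-- Incomparability with respect to `r`. -/
def Incomp (r : X → X → Prop) (x y : X) : Prop := ¬ Comp r x y

theorem ParRel.unlinked {S₁ S₂ : Set X} (h : ParRel r S₁ S₂) : Unlinked (Comp r) S₁ S₂ :=
  ⟨h.1, fun x hx y hy => by have := h.2 x hx y hy; simp only [Comp]; tauto⟩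

theorem SeqRel.unlinked {S₁ S₂ : Set X} (h : SeqRel r S₁ S₂) : Unlinked (Incomp r) S₁ S₂ :=
  ⟨h.1, fun x hx y hy => by have := h.2 x hx y hy; simp only [Incomp, Comp]; tauto⟩

theorem RealizesAnd.linked_incomp {ts : SandTreeList B} {S : Set X} (h : RealizesAnd r lab ts S)
    (h2 : 2 ≤ ts.toList.length) : Linked (Incomp r) S ∧ ¬ Linked (Comp r) S := by
  cases ts with
  | single t => simp [SandTreeList.toList] at h2
  | cons t ts =>
    obtain ⟨S₁, S₂, rfl, h, h₁, h₂⟩ := h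
    refine ⟨linked_union h₁.nonempty h₂.nonempty fun x hx y hy => ?_,
      not_linked_union h₁.nonempty h₂.nonempty h.1 fun x hx y hy => (h.unlinked.2 x hx y hy).1⟩
    exact h.unlinked.2 x hx y hy

theorem RealizesSand.linked_comp {ts : SandTreeList B} {S : Set X} (h : RealizesSand r lab ts S)
    (h2 : 2 ≤ ts.toList.length) : Linked (Comp r) S ∧ ¬ Linked (Incomp r) S := by
  cases ts with
  | single t => simp [SandTreeList.toList] at h2
  | cons t ts =>
    obtain ⟨S₁, S₂, rfl, h, h₁, h₂⟩ := h
    refine ⟨linked_union h₁.nonempty h₂.nonempty fun x hx y hy => ?_,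
      not_linked_union h₁.nonempty h₂.nonempty h.1 fun x hx y hy => (h.unlinked.2 x hx y hy).1⟩
    have := h.2 x hx y hy
    exact ⟨.inl this.1, .inr this.1⟩

theorem IsS.linked {t : SandTree B} {S : Set X} (ht : IsS t) (h : Realizes r lab t S) :
    Linked (Comp r) S := by
  cases ht with
  | atom b =>
    obtain ⟨x, -, rfl⟩ := h
    exact linked_singleton _ _
  | sand h2 _ => exact (RealizesSand.linked_comp h h2).1

theorem IsC.linked {t : SandTree B} {S : Set X} (ht : IsC t) (h : Realizes r lab t S) :
    Linked (Incomp r) S := by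
  cases ht with
  | atom b =>
    obtain ⟨x, -, rfl⟩ := h
    exact linked_singleton _ _
  | and h2 _ => exact (RealizesAnd.linked_incomp h h2).1

theorem isSL_iff : ∀ {ts : SandTreeList B}, IsSL ts ↔ ∀ u ∈ ts.toList, IsS u
  | .single t => ⟨by rintro ⟨h⟩; simpa [SandTreeList.toList],
      fun h => .single (h t (by simp [SandTreeList.toList]))⟩
  | .cons t ts => ⟨by
      rintro (_ | ⟨h, hs⟩)
      simpa [SandTreeList.toList] using ⟨h, isSL_iff.1 hs⟩,
      fun h => .cons (h t (by simp [SandTreeList.toList]))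
        (isSL_iff.2 fun u hu => h u (by simp [SandTreeList.toList, hu]))⟩

theorem isCL_iff : ∀ {ts : SandTreeList B}, IsCL ts ↔ ∀ u ∈ ts.toList, IsC u
  | .single t => ⟨by rintro ⟨h⟩; simpa [SandTreeList.toList],
      fun h => .single (h t (by simp [SandTreeList.toList]))⟩
  | .cons t ts => ⟨by
      rintro (_ | ⟨h, hs⟩)
      simpa [SandTreeList.toList] using ⟨h, isCL_iff.1 hs⟩,
      fun h => .cons (h t (by simp [SandTreeList.toList]))
        (isCL_iff.2 fun u hu => h u (by simp [SandTreeList.toList, hu]))⟩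

theorem linked_of_forall₂ {q : X → X → Prop} {P : SandTree B → Prop} {l : List (SandTree B)}
    {Ss : List (Set X)} (hPq : ∀ {t S}, P t → Realizes r lab t S → Linked q S)
    (hf : List.Forall₂ (Realizes r lab) l Ss) (hP : ∀ u ∈ l, P u) : ∀ A ∈ Ss, Linked q A := by
  induction hf with
  | nil => simp
  | cons h _ ih =>
    intro A hA
    rcases List.mem_cons.1 hA with rfl | hA
    · exact hPq (hP _ List.mem_cons_self) h
    · exact ih (fun u hu => hP u (List.mem_cons_of_mem _ hu)) A hA

theorem forall₂_of_forall₂_realizes {P : SandTree B → SandTree B → Prop} {l l' : List (SandTree B)}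
    {Ss : List (Set X)} (hf : List.Forall₂ (Realizes r lab) l Ss)
    (hf' : List.Forall₂ (Realizes r lab) l' Ss)
    (hP : ∀ u ∈ l, ∀ u' ∈ l', ∀ S, Realizes r lab u S → Realizes r lab u' S → P u u') :
    List.Forall₂ P l l' := by
  induction hf generalizing l' with
  | nil => cases hf'; exact .nil
  | cons h _ ih =>
    cases hf' with
    | cons h' hf' =>
      exact .cons (hP _ List.mem_cons_self _ List.mem_cons_self _ h h')
        (ih hf' fun u hu u' hu' => hP u (List.mem_cons_of_mem _ hu) u' (List.mem_cons_of_mem _ hu'))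

theorem SandTreeList.exists_toList_eq :
    ∀ {l : List (SandTree B)}, l ≠ [] → ∃ ts : SandTreeList B, ts.toList = l
  | [t], _ => ⟨.single t, rfl⟩
  | t :: u :: l, _ => by
    obtain ⟨ts, hts⟩ := SandTreeList.exists_toList_eq (List.cons_ne_nil u l)
    exact ⟨.cons t ts, by rw [SandTreeList.toList, hts]⟩

theorem SandTreeList.toList_ne_nil : ∀ ts : SandTreeList B, ts.toList ≠ []
  | .single _ => List.cons_ne_nil _ _
  | .cons _ _ => List.cons_ne_nil _ _

theorem PEqL.of_forall₂ : ∀ {ts ts' : SandTreeList B},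
    List.Forall₂ PEq ts.toList ts'.toList → PEqL ts ts'
  | .single t, .single t', h => by
    simp only [SandTreeList.toList, List.forall₂_cons] at h
    exact .single h.1
  | .cons t ts, .cons t' ts', h => by
    simp only [SandTreeList.toList, List.forall₂_cons] at h
    exact .cons h.1 (PEqL.of_forall₂ h.2)
  | .single t, .cons t' ts', h => by
    simp only [SandTreeList.toList, List.forall₂_cons, List.forall₂_nil_left_iff] at h
    exact (ts'.toList_ne_nil h.2).elim
  | .cons t ts, .single t', h => by
    simp only [SandTreeList.toList, List.forall₂_cons, List.forall₂_nil_right_iff] at h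
    exact (ts.toList_ne_nil h.2).elim

/-- The property that a term is determined, among `A`-terms, by any structure it describes. -/
def Determined (r : X → X → Prop) (lab : X → B) (t : SandTree B) : Prop :=
  ∀ ⦃t' : SandTree B⦄ ⦃S : Set X⦄, IsA t → IsA t' → Realizes r lab t S → Realizes r lab t' S → PEq t t'

theorem peq_and {ts ts' : SandTreeList B} {S : Set X}
    (ih : ∀ u ∈ ts.toList, Determined r lab u) (hts : IsSL ts) (hts' : IsSL ts')
    (h : RealizesAnd r lab ts S) (h' : RealizesAnd r lab ts' S) : PEq (.and ts) (.and ts') := by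
  rw [isSL_iff] at hts hts'
  obtain ⟨Ss, hf, hp, hS⟩ := h.exists_blocks
  obtain ⟨Ss', hf', hp', hS'⟩ := h'.exists_blocks
  have hperm : Ss.Perm Ss' := perm_of_blocks (q := Comp r) hS hS'
    (hp.imp fun h => h.unlinked) (hp'.imp fun h => h.unlinked)
    (linked_of_forall₂ (fun h => h.linked) hf hts) (linked_of_forall₂ (fun h => h.linked) hf' hts')
  obtain ⟨l, hl, hlp⟩ := List.perm_comp_forall₂ hperm hf'.flip
  have hl' : l ≠ [] := fun h => ts'.toList_ne_nil (by simpa [h] using hlp)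
  obtain ⟨us, rfl⟩ := SandTreeList.exists_toList_eq hl'
  refine (PEq.andCongr (PEqL.of_forall₂ (forall₂_of_forall₂_realizes hf hl.flip ?_))).trans
    (PEq.andPerm hlp)
  intro u hu u' hu' S h h'
  exact ih u hu (.inr (hts u hu)) (.inr (hts' u' (hlp.subset hu'))) h h'

theorem peq_sand {ts ts' : SandTreeList B} {S : Set X}
    (ih : ∀ u ∈ ts.toList, Determined r lab u) (hts : IsCL ts) (hts' : IsCL ts')
    (h : RealizesSand r lab ts S) (h' : RealizesSand r lab ts' S) : PEq (.sand ts) (.sand ts') := by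
  rw [isCL_iff] at hts hts'
  obtain ⟨Ss, hf, hp, hS⟩ := h.exists_blocks
  obtain ⟨Ss', hf', hp', hS'⟩ := h'.exists_blocks
  have hl := linked_of_forall₂ (fun h => h.linked) hf hts
  have hl' := linked_of_forall₂ (fun h => h.linked) hf' hts'
  have hperm : Ss.Perm Ss' := perm_of_blocks (q := Incomp r) hS hS'
    (hp.imp fun h => h.unlinked) (hp'.imp fun h => h.unlinked) hl hl'
  obtain rfl : Ss = Ss' := by
    refine hperm.eq_of_pairwise (fun A C hA hC hAC hCA => ?_) hp hp'
    obtain ⟨a, ha⟩ := (hl A hA).1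
    obtain ⟨c, hc⟩ := (hl' C hC).1
    exact absurd (hAC.2 a ha c hc).1 (hCA.2 c hc a ha).2
  refine PEq.sandCongr (PEqL.of_forall₂ (forall₂_of_forall₂_realizes hf hf' ?_))
  intro u hu u' hu' S h h'
  exact ih u hu (.inl (hts u hu)) (.inl (hts' u' hu')) h h'

theorem peq_atom {b b' : B} {S : Set X} (h : Realizes r lab (.atom b) S)
    (h' : Realizes r lab (.atom b') S) : PEq (.atom b) (.atom b') := by
  obtain ⟨x, rfl, rfl⟩ := h
  obtain ⟨y, rfl, hy⟩ := h'
  rw [Set.singleton_injective hy]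
  exact .refl _

theorem determined_step {t : SandTree B}
    (ihand : ∀ ts, t = .and ts → ∀ u ∈ ts.toList, Determined r lab u)
    (ihsand : ∀ ts, t = .sand ts → ∀ u ∈ ts.toList, Determined r lab u) :
    Determined r lab t := by
  intro t' S ht ht' h h'
  rcases ht with (⟨b⟩ | ⟨h2, hts⟩) | (⟨b⟩ | ⟨h2, hts⟩) <;>
    rcases ht' with (⟨b'⟩ | ⟨h2', hts'⟩) | (⟨b'⟩ | ⟨h2', hts'⟩)
  all_goals first
    | exact peq_and (ihand _ rfl) hts hts' h h'
    | exact peq_sand (ihsand _ rfl) hts hts' h h'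
    | exact ((RealizesAnd.linked_incomp h h2).2 ((IsS.atom _).linked h')).elim
    | exact ((RealizesAnd.linked_incomp h h2).2 (RealizesSand.linked_comp h' h2').1).elim
    | exact ((RealizesSand.linked_comp h h2).2 ((IsC.atom _).linked h')).elim
    | exact ((RealizesSand.linked_comp h h2).2 (RealizesAnd.linked_incomp h' h2').1).elim
    | exact ((RealizesAnd.linked_incomp h' h2').2 ((IsS.atom _).linked h)).elim
    | exact ((RealizesSand.linked_comp h' h2').2 ((IsC.atom _).linked h)).elim
    | exact peq_atom h h'

mutual
theorem determined (r : X → X → Prop) (lab : X → B) : ∀ t : SandTree B, Determined r lab t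
  | .atom b => determined_step (by simp) (by simp)
  | .or ts => determined_step (by simp) (by simp)
  | .and ts => determined_step (by rintro _ ⟨⟩; exact determined_list r lab ts) (by simp)
  | .sand ts => determined_step (by simp) (by rintro _ ⟨⟩; exact determined_list r lab ts)
theorem determined_list (r : X → X → Prop) (lab : X → B) :
    ∀ (ts : SandTreeList B), ∀ u ∈ ts.toList, Determined r lab u
  | .single t => by simpa [SandTreeList.toList] using determined r lab t
  | .cons t ts => by
    simpa [SandTreeList.toList] using ⟨determined r lab t, determined_list r lab ts⟩
end

end Order

namespace SSG

variable {B : Type}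

/-- The action of a vertex map on labeled edges. -/
def edgeMap {V W : Type} (f : V → W) (e : V × B × V) : W × B × W := (f e.1, e.2.1, f e.2.2)

theorem map_edgeMap_map {V W U : Type} (f : V → W) (g : W → U) (E : Multiset (V × B × V)) :
    (E.map (edgeMap f)).map (edgeMap g) = E.map (edgeMap (g ∘ f)) := by
  rw [Multiset.map_map]; rfl

theorem Iso.refl (G : SSG B) : G.Iso G := ⟨Equiv.refl _, by simp, rfl, rfl⟩

theorem Iso.trans {G H K : SSG B} : G.Iso H → H.Iso K → G.Iso K := by
  rintro ⟨f, hE, hs, hz⟩ ⟨g, hE', hs', hz'⟩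
  refine ⟨f.trans g, ?_, by simp [hs, hs'], by simp [hz, hz']⟩
  rw [← hE', ← hE, Multiset.map_map]
  rfl

theorem Iso.symm {G H : SSG B} : G.Iso H → H.Iso G := by
  rintro ⟨f, hE, hs, hz⟩
  refine ⟨f.symm, ?_, by simp [← hs], by simp [← hz]⟩
  rw [← hE, Multiset.map_map]
  simp

/-- `H` is covered by copies of `G₁` and `G₂`, whose vertices are identified according to `R`. -/
structure IsGlue (G₁ G₂ H : SSG B) (R : G₁.V → G₂.V → Prop) (i : G₁.V → H.V) (j : G₂.V → H.V) :
    Prop where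
  inj_left : i.Injective
  inj_right : j.Injective
  eq_iff : ∀ u v, i u = j v ↔ R u v
  surj : ∀ w, (∃ u, i u = w) ∨ ∃ v, j v = w
  edges : H.E = G₁.E.map (edgeMap i) + G₂.E.map (edgeMap j)

/-- `H` is a parallel composition of `G₁` and `G₂` along the embeddings `i` and `j`. -/
structure IsPar (G₁ G₂ H : SSG B) (i : G₁.V → H.V) (j : G₂.V → H.V) : Prop extends
    IsGlue G₁ G₂ H (fun u v => u = G₁.s ∧ v = G₂.s ∨ u = G₁.z ∧ v = G₂.z) i j where
  map_s : i G₁.s = H.s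
  map_z : i G₁.z = H.z

/-- `H` is a sequential composition of `G₁` and `G₂` along the embeddings `i` and `j`. -/
structure IsSeq (G₁ G₂ H : SSG B) (i : G₁.V → H.V) (j : G₂.V → H.V) : Prop extends
    IsGlue G₁ G₂ H (fun u v => u = G₁.z ∧ v = G₂.s) i j where
  map_s : i G₁.s = H.s
  map_z : j G₂.z = H.z

theorem isPar_par (G₁ G₂ : SSG B) : IsPar G₁ G₂ (G₁.par G₂) (G₁.parEmbed G₂) Sum.inr where
  inj_left u v h := by
    have h₁ := G₁.ne
    have h₂ := G₂.ne
    unfold parEmbed at h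
    grind
  inj_right := Sum.inr_injective
  eq_iff u v := by
    have h₁ := G₁.ne
    have h₂ := G₂.ne
    unfold parEmbed
    grind
  surj := by
    rintro (⟨u, hs, hz⟩ | v)
    · exact .inl ⟨u, (dif_neg hs).trans (dif_neg hz)⟩
    · exact .inr ⟨v, rfl⟩
  edges := rfl
  map_s := by simp [parEmbed, par]
  map_z := by simp [parEmbed, par, G₁.ne.symm]

theorem isSeq_seq (G₁ G₂ : SSG B) : IsSeq G₁ G₂ (G₁.seq G₂) (G₁.seqEmbed G₂) Sum.inr where
  inj_left u v h := by
    unfold seqEmbed at h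
    grind
  inj_right := Sum.inr_injective
  eq_iff u v := by
    unfold seqEmbed
    grind
  surj := by
    rintro (⟨u, hz⟩ | v)
    · exact .inl ⟨u, dif_neg hz⟩
    · exact .inr ⟨v, rfl⟩
  edges := rfl
  map_s := by simp [seqEmbed, seq, G₁.ne]
  map_z := rfl

variable {G₁ G₂ G₃ H H' K L : SSG B}

namespace IsGlue

variable {R : G₁.V → G₂.V → Prop} {i : G₁.V → H.V} {j : G₂.V → H.V}

theorem exists_lift (h : IsGlue G₁ G₂ H R i j) {W : Type} (a : G₁.V → W) (b : G₂.V → W)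
    (hab : ∀ u v, R u v → a u = b v) :
    ∃ f : H.V → W, (∀ u, f (i u) = a u) ∧ ∀ v, f (j v) = b v := by
  have : ∀ w, ∃ c : W, (∀ u, i u = w → a u = c) ∧ ∀ v, j v = w → b v = c := by
    intro w
    rcases h.surj w with ⟨u, rfl⟩ | ⟨v, rfl⟩
    · exact ⟨a u, fun u' hu => by rw [h.inj_left hu],
        fun v hv => (hab u v ((h.eq_iff u v).1 hv.symm)).symm⟩
    · exact ⟨b v, fun u hu => hab u v ((h.eq_iff u v).1 hu), fun v' hv => by rw [h.inj_right hv]⟩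
  choose f hf using this
  exact ⟨f, fun u => ((hf _).1 u rfl).symm, fun v => ((hf _).2 v rfl).symm⟩

theorem lift_injective (h : IsGlue G₁ G₂ H R i j) {W : Type} {a : G₁.V → W} {b : G₂.V → W}
    {f : H.V → W} (hfi : ∀ u, f (i u) = a u) (hfj : ∀ v, f (j v) = b v) (ha : a.Injective)
    (hb : b.Injective) (hab : ∀ u v, a u = b v → R u v) : f.Injective := by
  intro w w' hw
  rcases h.surj w with ⟨u, rfl⟩ | ⟨v, rfl⟩ <;> rcases h.surj w' with ⟨u', rfl⟩ | ⟨v', rfl⟩ <;>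
    simp only [hfi, hfj] at hw
  · rw [ha hw]
  · exact (h.eq_iff u v').2 (hab u v' hw)
  · exact ((h.eq_iff u' v).2 (hab u' v hw.symm)).symm
  · rw [hb hw]

theorem exists_equiv (h : IsGlue G₁ G₂ H R i j) {i' : G₁.V → H'.V} {j' : G₂.V → H'.V}
    (h' : IsGlue G₁ G₂ H' R i' j') :
    ∃ f : H.V ≃ H'.V, H.E.map (edgeMap f) = H'.E ∧ (∀ u, f (i u) = i' u) ∧
      ∀ v, f (j v) = j' v := by
  obtain ⟨f, hfi, hfj⟩ := h.exists_lift i' j' fun u v huv => (h'.eq_iff u v).2 huv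
  have hf : f.Bijective := by
    refine ⟨h.lift_injective hfi hfj h'.inj_left h'.inj_right fun u v => (h'.eq_iff u v).1, ?_⟩
    intro w
    rcases h'.surj w with ⟨u, rfl⟩ | ⟨v, rfl⟩
    · exact ⟨_, hfi u⟩
    · exact ⟨_, hfj v⟩
  refine ⟨Equiv.ofBijective f hf, ?_, hfi, hfj⟩
  rw [h.edges, h'.edges, Multiset.map_add, map_edgeMap_map, map_edgeMap_map]
  simp only [Equiv.ofBijective_apply, Function.comp_def, hfi, hfj]

theorem symm (h : IsGlue G₁ G₂ H R i j) : IsGlue G₂ G₁ H (fun v u => R u v) j i where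
  inj_left := h.inj_right
  inj_right := h.inj_left
  eq_iff v u := by rw [← h.eq_iff u v, eq_comm]
  surj w := (h.surj w).symm
  edges := by rw [h.edges, add_comm]

theorem comp_equiv (h : IsGlue G₁ G₂ H R i j) {H₁ H₂ : SSG B} {f₁ : H₁.V ≃ G₁.V}
    {f₂ : H₂.V ≃ G₂.V} (h₁ : H₁.E.map (edgeMap f₁) = G₁.E) (h₂ : H₂.E.map (edgeMap f₂) = G₂.E) :
    IsGlue H₁ H₂ H (fun u v => R (f₁ u) (f₂ v)) (i ∘ f₁) (j ∘ f₂) where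
  inj_left := h.inj_left.comp f₁.injective
  inj_right := h.inj_right.comp f₂.injective
  eq_iff u v := h.eq_iff _ _
  surj w := (h.surj w).imp (fun ⟨u, hu⟩ => ⟨f₁.symm u, by simpa⟩)
    fun ⟨v, hv⟩ => ⟨f₂.symm v, by simpa⟩
  edges := by rw [h.edges, ← h₁, ← h₂, map_edgeMap_map, map_edgeMap_map]

theorem equiv_comp (h : IsGlue G₁ G₂ H R i j) {f : H.V ≃ H'.V} (hf : H.E.map (edgeMap f) = H'.E) :
    IsGlue G₁ G₂ H' R (f ∘ i) (f ∘ j) where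
  inj_left := f.injective.comp h.inj_left
  inj_right := f.injective.comp h.inj_right
  eq_iff u v := by simp [h.eq_iff]
  surj w := (h.surj (f.symm w)).imp (fun ⟨u, hu⟩ => ⟨u, by simp [hu]⟩)
    fun ⟨v, hv⟩ => ⟨v, by simp [hv]⟩
  edges := by rw [← hf, h.edges, Multiset.map_add, map_edgeMap_map, map_edgeMap_map]

/-- Reassociating a gluing of `G₁` with a gluing `K` of `G₂` and `G₃`. -/
theorem assoc {R₁ : G₁.V → K.V → Prop} {R₂ : G₂.V → G₃.V → Prop} {R₃ : G₁.V → G₂.V → Prop}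
    {i : G₁.V → H.V} {j : K.V → H.V} {i' : G₂.V → K.V} {j' : G₃.V → K.V} {p : G₁.V → L.V}
    {q : G₂.V → L.V} (h : IsGlue G₁ K H R₁ i j) (hK : IsGlue G₂ G₃ K R₂ i' j')
    (hL : IsGlue G₁ G₂ L R₃ p q) (hR : ∀ u v, R₃ u v ↔ R₁ u (i' v)) :
    ∃ f : L.V → H.V, (∀ u, f (p u) = i u) ∧ (∀ v, f (q v) = j (i' v)) ∧
      IsGlue L G₃ H (fun w v => f w = j (j' v)) f (j ∘ j') := by
  have hR' : ∀ u v, R₃ u v ↔ i u = j (i' v) := fun u v => by rw [hR, h.eq_iff]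
  obtain ⟨f, hfp, hfq⟩ := hL.exists_lift i (j ∘ i') fun u v huv => (hR' u v).1 huv
  refine ⟨f, hfp, hfq, ?_, h.inj_right.comp hK.inj_right, fun _ _ => Iff.rfl, fun w => ?_, ?_⟩
  · exact hL.lift_injective hfp hfq h.inj_left (h.inj_right.comp hK.inj_left)
      fun u v => (hR' u v).2
  · rcases h.surj w with ⟨u, rfl⟩ | ⟨k, rfl⟩
    · exact .inl ⟨_, hfp u⟩
    · rcases hK.surj k with ⟨v, rfl⟩ | ⟨v, rfl⟩
      · exact .inl ⟨_, hfq v⟩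
      · exact .inr ⟨v, rfl⟩
  · rw [h.edges, hK.edges, hL.edges, Multiset.map_add, Multiset.map_add]
    simp only [map_edgeMap_map, Function.comp_def, hfp, hfq]
    rw [add_assoc]

theorem adj_iff (h : IsGlue G₁ G₂ H R i j) {w w' : H.V} :
    H.Adj w w' ↔ (∃ u u', G₁.Adj u u' ∧ i u = w ∧ i u' = w') ∨
      ∃ v v', G₂.Adj v v' ∧ j v = w ∧ j v' = w' := by
  simp only [Adj, h.edges, Multiset.mem_add, Multiset.mem_map, edgeMap, Prod.mk.injEq, Prod.exists]
  grind

end IsGlue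

namespace IsPar

variable {i : G₁.V → H.V} {j : G₂.V → H.V}

theorem map_s' (h : IsPar G₁ G₂ H i j) : j G₂.s = H.s := by
  rw [← h.map_s, eq_comm, h.eq_iff]; simp

theorem map_z' (h : IsPar G₁ G₂ H i j) : j G₂.z = H.z := by
  rw [← h.map_z, eq_comm, h.eq_iff]; simp

theorem iso (h : IsPar G₁ G₂ H i j) {i' : G₁.V → H'.V} {j' : G₂.V → H'.V}
    (h' : IsPar G₁ G₂ H' i' j') : H.Iso H' := by
  obtain ⟨f, hE, hfi, -⟩ := h.exists_equiv h'.toIsGlue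
  exact ⟨f, hE, by rw [← h.map_s, hfi, h'.map_s], by rw [← h.map_z, hfi, h'.map_z]⟩

theorem symm (h : IsPar G₁ G₂ H i j) : IsPar G₂ G₁ H j i where
  toIsGlue := by simpa only [and_comm] using h.toIsGlue.symm
  map_s := h.map_s'
  map_z := h.map_z'

theorem trans_iso (h : IsPar G₁ G₂ H i j) (hH : H.Iso H') : ∃ i' j', IsPar G₁ G₂ H' i' j' := by
  obtain ⟨f, hE, hs, hz⟩ := hH
  exact ⟨f ∘ i, f ∘ j, h.equiv_comp hE, by simp [h.map_s, hs], by simp [h.map_z, hz]⟩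

theorem assoc {i : G₁.V → H.V} {j : K.V → H.V} {i' : G₂.V → K.V} {j' : G₃.V → K.V}
    (h : IsPar G₁ K H i j) (hK : IsPar G₂ G₃ K i' j') : ((G₁.par G₂).par G₃).Iso H := by
  have hL := isPar_par G₁ G₂
  obtain ⟨f, hfp, hfq, hf⟩ := h.toIsGlue.assoc hK.toIsGlue hL.toIsGlue fun u v => by
    rw [← hK.map_s, ← hK.map_z, hK.inj_left.eq_iff, hK.inj_left.eq_iff]
  have hs : f (G₁.par G₂).s = H.s := by rw [← hL.map_s, hfp, h.map_s]
  have hz : f (G₁.par G₂).z = H.z := by rw [← hL.map_z, hfp, h.map_z]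
  refine (isPar_par _ _).iso (i' := f) (j' := j ∘ j') ⟨?_, hs, hz⟩
  convert hf using 3 with w v
  rw [← hf.inj_left.eq_iff, ← hf.inj_left.eq_iff, hs, hz, ← hK.inj_right.eq_iff,
    ← hK.inj_right.eq_iff, hK.map_s', hK.map_z', ← h.inj_right.eq_iff, ← h.inj_right.eq_iff,
    h.map_s', h.map_z']
  constructor
  · rintro (⟨h₁, h₂⟩ | ⟨h₁, h₂⟩) <;> rw [h₁, h₂]
  · intro hw
    rw [hw, and_self, and_self]
    rcases hL.surj w with ⟨u, rfl⟩ | ⟨u, rfl⟩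
    · rw [hfp, h.eq_iff] at hw
      rw [← h.map_s', ← h.map_z', h.inj_right.eq_iff, h.inj_right.eq_iff]
      exact hw.imp And.right And.right
    · rw [hfq, h.inj_right.eq_iff, hK.eq_iff] at hw
      rw [← h.map_s', ← h.map_z', ← hK.map_s', ← hK.map_z']
      exact hw.imp (fun hv => by rw [hv.2]) fun hv => by rw [hv.2]

end IsPar

theorem IsPar.exists_of_iso {H₁ H₂ : SSG B} {i : H₁.V → H.V} {j : H₂.V → H.V}
    (h : IsPar H₁ H₂ H i j) (h₁ : G₁.Iso H₁) (h₂ : G₂.Iso H₂) : ∃ i' j', IsPar G₁ G₂ H i' j' := by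
  obtain ⟨f₁, hE₁, hs₁, hz₁⟩ := h₁
  obtain ⟨f₂, hE₂, hs₂, hz₂⟩ := h₂
  refine ⟨i ∘ f₁, j ∘ f₂, ?_, by simp [hs₁, h.map_s], by simp [hz₁, h.map_z]⟩
  simpa only [← hs₁, ← hs₂, ← hz₁, ← hz₂, EmbeddingLike.apply_eq_iff_eq] using
    h.toIsGlue.comp_equiv hE₁ hE₂

theorem Iso.par_congr {H₁ H₂ : SSG B} (h₁ : G₁.Iso H₁) (h₂ : G₂.Iso H₂) :
    (G₁.par G₂).Iso (H₁.par H₂) := by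
  obtain ⟨i, j, h⟩ := (isPar_par H₁ H₂).exists_of_iso h₁ h₂
  exact (isPar_par G₁ G₂).iso h

namespace IsSeq

variable {i : G₁.V → H.V} {j : G₂.V → H.V}

theorem map_mid (h : IsSeq G₁ G₂ H i j) : i G₁.z = j G₂.s := by
  rw [h.eq_iff]; simp

theorem iso (h : IsSeq G₁ G₂ H i j) {i' : G₁.V → H'.V} {j' : G₂.V → H'.V}
    (h' : IsSeq G₁ G₂ H' i' j') : H.Iso H' := by
  obtain ⟨f, hE, hfi, hfj⟩ := h.exists_equiv h'.toIsGlue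
  exact ⟨f, hE, by rw [← h.map_s, hfi, h'.map_s], by rw [← h.map_z, hfj, h'.map_z]⟩

theorem trans_iso (h : IsSeq G₁ G₂ H i j) (hH : H.Iso H') : ∃ i' j', IsSeq G₁ G₂ H' i' j' := by
  obtain ⟨f, hE, hs, hz⟩ := hH
  exact ⟨f ∘ i, f ∘ j, h.equiv_comp hE, by simp [h.map_s, hs], by simp [h.map_z, hz]⟩

theorem assoc {i : G₁.V → H.V} {j : K.V → H.V} {i' : G₂.V → K.V} {j' : G₃.V → K.V}
    (h : IsSeq G₁ K H i j) (hK : IsSeq G₂ G₃ K i' j') : ((G₁.seq G₂).seq G₃).Iso H := by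
  have hL := isSeq_seq G₁ G₂
  obtain ⟨f, hfp, hfq, hf⟩ := h.toIsGlue.assoc hK.toIsGlue hL.toIsGlue fun u v => by
    rw [← hK.map_s, hK.inj_left.eq_iff]
  have hs : f (G₁.seq G₂).s = H.s := by rw [← hL.map_s, hfp, h.map_s]
  have hz : f (G₁.seq G₂).z = j (j' G₃.s) := by rw [← hL.map_z, hfq, hK.map_mid]
  refine (isSeq_seq _ _).iso (i' := f) (j' := j ∘ j') ⟨?_, hs, by simp [hK.map_z, h.map_z]⟩
  convert hf using 3 with w v
  rw [← hf.inj_left.eq_iff, hz]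
  constructor
  · rintro ⟨h₁, rfl⟩
    exact h₁
  · intro hw
    suffices v = G₃.s from ⟨this ▸ hw, this⟩
    rcases hL.surj w with ⟨u, rfl⟩ | ⟨u, rfl⟩
    · rw [hfp, h.eq_iff, ← hK.map_s] at hw
      exact ((hK.eq_iff _ _).1 hw.2.symm).2
    · rw [hfq, h.inj_right.eq_iff, hK.eq_iff] at hw
      exact hw.2

end IsSeq

theorem IsSeq.exists_of_iso {H₁ H₂ : SSG B} {i : H₁.V → H.V} {j : H₂.V → H.V}
    (h : IsSeq H₁ H₂ H i j) (h₁ : G₁.Iso H₁) (h₂ : G₂.Iso H₂) : ∃ i' j', IsSeq G₁ G₂ H i' j' := by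
  obtain ⟨f₁, hE₁, hs₁, hz₁⟩ := h₁
  obtain ⟨f₂, hE₂, hs₂, hz₂⟩ := h₂
  refine ⟨i ∘ f₁, j ∘ f₂, ?_, by simp [hs₁, h.map_s], by simp [hz₂, h.map_z]⟩
  simpa only [← hz₁, ← hs₂, EmbeddingLike.apply_eq_iff_eq] using h.toIsGlue.comp_equiv hE₁ hE₂

theorem Iso.seq_congr {H₁ H₂ : SSG B} (h₁ : G₁.Iso H₁) (h₂ : G₂.Iso H₂) :
    (G₁.seq G₂).Iso (H₁.seq H₂) := by
  obtain ⟨i, j, h⟩ := (isSeq_seq H₁ H₂).exists_of_iso h₁ h₂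
  exact (isSeq_seq G₁ G₂).iso h

theorem par_assoc (G₁ G₂ G₃ : SSG B) : ((G₁.par G₂).par G₃).Iso (G₁.par (G₂.par G₃)) :=
  (isPar_par _ _).assoc (isPar_par _ _)

theorem seq_assoc (G₁ G₂ G₃ : SSG B) : ((G₁.seq G₂).seq G₃).Iso (G₁.seq (G₂.seq G₃)) :=
  (isSeq_seq _ _).assoc (isSeq_seq _ _)

end SSG

namespace SSG

variable {B : Type}

/-- Directed reachability. -/
def Reach (G : SSG B) : G.V → G.V → Prop := Relation.ReflTransGen G.Adj

/-- No edge enters the source or leaves the sink, and every edge lies on a path from the source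
to the sink. -/
structure Proper (G : SSG B) : Prop where
  not_adj_s : ∀ u, ¬ G.Adj u G.s
  not_z_adj : ∀ u, ¬ G.Adj G.z u
  reach_of_adj : ∀ u v, G.Adj u v → G.Reach G.s u
  reach_z_of_adj : ∀ u v, G.Adj u v → G.Reach v G.z
  reach_s_z : G.Reach G.s G.z

variable {G₁ G₂ H : SSG B}

theorem Proper.ne_s {u v : H.V} (h : H.Proper) (huv : H.Adj u v) : v ≠ H.s := by
  rintro rfl
  exact h.not_adj_s _ huv

theorem Proper.ne_z {u v : H.V} (h : H.Proper) (huv : H.Adj u v) : u ≠ H.z := by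
  rintro rfl
  exact h.not_z_adj _ huv

theorem Proper.ne_s_of_reach {u v : H.V} (h : H.Proper) (hu : u ≠ H.s) (huv : H.Reach u v) :
    v ≠ H.s := by
  induction huv with
  | refl => exact hu
  | tail _ hbc _ => exact h.ne_s hbc

theorem IsGlue.reach_left {R : G₁.V → G₂.V → Prop} {i : G₁.V → H.V} {j : G₂.V → H.V}
    (h : IsGlue G₁ G₂ H R i j) {u u' : G₁.V} (hu : G₁.Reach u u') : H.Reach (i u) (i u') :=
  Relation.ReflTransGen.lift i (fun _ _ hab => h.adj_iff.2 (.inl ⟨_, _, hab, rfl, rfl⟩)) _ _ hu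

theorem IsGlue.reach_right {R : G₁.V → G₂.V → Prop} {i : G₁.V → H.V} {j : G₂.V → H.V}
    (h : IsGlue G₁ G₂ H R i j) {u u' : G₂.V} (hu : G₂.Reach u u') : H.Reach (j u) (j u') :=
  h.symm.reach_left hu

namespace IsPar

variable {i : G₁.V → H.V} {j : G₂.V → H.V}

theorem exists_of_reach (h : IsPar G₁ G₂ H i j) (h₁ : G₁.Proper) (h₂ : G₂.Proper) {u : G₁.V}
    {w : H.V} (hu : u ≠ G₁.s) (hw : H.Reach (i u) w) : ∃ u', i u' = w ∧ G₁.Reach u u' := by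
  induction hw with
  | refl => exact ⟨u, rfl, .refl⟩
  | tail _ hbc ih =>
    obtain ⟨u', rfl, hu'⟩ := ih
    rcases h.adj_iff.1 hbc with ⟨a, a', ha, hi, rfl⟩ | ⟨v, v', hv, hj, rfl⟩
    · rw [h.inj_left hi] at ha
      exact ⟨a', rfl, hu'.tail ha⟩
    · rcases (h.eq_iff _ _).1 hj.symm with ⟨hs, -⟩ | ⟨-, rfl⟩
      · exact (h₁.ne_s_of_reach hu hu' hs).elim
      · exact (h₂.not_z_adj _ hv).elim

theorem reach_left_iff (h : IsPar G₁ G₂ H i j) (h₁ : G₁.Proper) (h₂ : G₂.Proper) {u u' : G₁.V}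
    (hu : u ≠ G₁.s) : H.Reach (i u) (i u') ↔ G₁.Reach u u' := by
  refine ⟨fun hr => ?_, h.reach_left⟩
  obtain ⟨a, ha, hua⟩ := h.exists_of_reach h₁ h₂ hu hr
  rwa [← h.inj_left ha]

theorem not_reach (h : IsPar G₁ G₂ H i j) (h₁ : G₁.Proper) (h₂ : G₂.Proper) {u : G₁.V} {v : G₂.V}
    (hu : u ≠ G₁.s) (hv : v ≠ G₂.z) : ¬ H.Reach (i u) (j v) := by
  intro hr
  obtain ⟨a, ha, hua⟩ := h.exists_of_reach h₁ h₂ hu hr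
  rcases (h.eq_iff _ _).1 ha with ⟨hs, -⟩ | ⟨-, hz⟩
  · exact h₁.ne_s_of_reach hu hua hs
  · exact hv hz

theorem proper (h : IsPar G₁ G₂ H i j) (h₁ : G₁.Proper) (h₂ : G₂.Proper) : H.Proper where
  not_adj_s w hw := by
    rcases h.adj_iff.1 hw with ⟨u, u', hu, -, hi⟩ | ⟨v, v', hv, -, hj⟩
    · exact h₁.ne_s hu (h.inj_left (hi.trans h.map_s.symm))
    · exact h₂.ne_s hv (h.inj_right (hj.trans h.map_s'.symm))
  not_z_adj w hw := by
    rcases h.adj_iff.1 hw with ⟨u, u', hu, hi, -⟩ | ⟨v, v', hv, hj, -⟩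
    · exact h₁.ne_z hu (h.inj_left (hi.trans h.map_z.symm))
    · exact h₂.ne_z hv (h.inj_right (hj.trans h.map_z'.symm))
  reach_of_adj w w' hw := by
    rcases h.adj_iff.1 hw with ⟨u, u', hu, rfl, -⟩ | ⟨v, v', hv, rfl, -⟩
    · rw [← h.map_s]
      exact h.reach_left (h₁.reach_of_adj _ _ hu)
    · rw [← h.map_s']
      exact h.reach_right (h₂.reach_of_adj _ _ hv)
  reach_z_of_adj w w' hw := by
    rcases h.adj_iff.1 hw with ⟨u, u', hu, -, rfl⟩ | ⟨v, v', hv, -, rfl⟩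
    · rw [← h.map_z]
      exact h.reach_left (h₁.reach_z_of_adj _ _ hu)
    · rw [← h.map_z']
      exact h.reach_right (h₂.reach_z_of_adj _ _ hv)
  reach_s_z := by
    rw [← h.map_s, ← h.map_z]
    exact h.reach_left h₁.reach_s_z

end IsPar

namespace IsSeq

variable {i : G₁.V → H.V} {j : G₂.V → H.V}

theorem exists_of_reach (h : IsSeq G₁ G₂ H i j) (h₁ : G₁.Proper) {v : G₂.V} {w : H.V}
    (hw : H.Reach (j v) w) : ∃ v', j v' = w ∧ G₂.Reach v v' := by
  induction hw with
  | refl => exact ⟨v, rfl, .refl⟩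
  | tail _ hbc ih =>
    obtain ⟨v', rfl, hv'⟩ := ih
    rcases h.adj_iff.1 hbc with ⟨a, a', ha, hi, rfl⟩ | ⟨b, b', hb, hj, rfl⟩
    · exact (h₁.ne_z ha ((h.eq_iff _ _).1 hi).1).elim
    · rw [h.inj_right hj] at hb
      exact ⟨b', rfl, hv'.tail hb⟩

theorem exists_of_reach_left (h : IsSeq G₁ G₂ H i j) (h₁ : G₁.Proper) {u : G₁.V} {w : H.V}
    (hw : H.Reach (i u) w) : (∃ u', i u' = w ∧ G₁.Reach u u') ∨ ∃ v, j v = w := by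
  induction hw with
  | refl => exact .inl ⟨u, rfl, .refl⟩
  | tail _ hbc ih =>
    rcases h.adj_iff.1 hbc with ⟨a, a', ha, rfl, rfl⟩ | ⟨b, b', -, -, rfl⟩
    · rcases ih with ⟨u', hi, hu'⟩ | ⟨v, hv⟩
      · rw [h.inj_left hi] at hu'
        exact .inl ⟨a', rfl, hu'.tail ha⟩
      · exact (h₁.ne_z ha ((h.eq_iff _ _).1 hv.symm).1).elim
    · exact .inr ⟨b', rfl⟩

theorem reach_left_iff (h : IsSeq G₁ G₂ H i j) (h₁ : G₁.Proper) {u u' : G₁.V}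
    (hu' : u' ≠ G₁.z) : H.Reach (i u) (i u') ↔ G₁.Reach u u' := by
  refine ⟨fun hr => ?_, h.reach_left⟩
  rcases h.exists_of_reach_left h₁ hr with ⟨a, ha, hua⟩ | ⟨v, hv⟩
  · rwa [← h.inj_left ha]
  · exact (hu' ((h.eq_iff _ _).1 hv.symm).1).elim

theorem reach_right_iff (h : IsSeq G₁ G₂ H i j) (h₁ : G₁.Proper) {v v' : G₂.V} :
    H.Reach (j v) (j v') ↔ G₂.Reach v v' := by
  refine ⟨fun hr => ?_, h.reach_right⟩
  obtain ⟨a, ha, hva⟩ := h.exists_of_reach h₁ hr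
  rwa [← h.inj_right ha]

theorem reach (h : IsSeq G₁ G₂ H i j) {u : G₁.V} {v : G₂.V} (hu : G₁.Reach u G₁.z)
    (hv : G₂.Reach G₂.s v) : H.Reach (i u) (j v) := by
  refine (h.reach_left hu).trans ?_
  rw [h.map_mid]
  exact h.reach_right hv

theorem not_reach (h : IsSeq G₁ G₂ H i j) (h₁ : G₁.Proper) {u : G₁.V} {v : G₂.V}
    (hu : u ≠ G₁.z) : ¬ H.Reach (j v) (i u) := by
  intro hr
  obtain ⟨b, hb, -⟩ := h.exists_of_reach h₁ hr
  exact hu ((h.eq_iff _ _).1 hb.symm).1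

theorem proper (h : IsSeq G₁ G₂ H i j) (h₁ : G₁.Proper) (h₂ : G₂.Proper) : H.Proper where
  not_adj_s w hw := by
    rcases h.adj_iff.1 hw with ⟨u, u', hu, -, hi⟩ | ⟨v, v', hv, -, hj⟩
    · exact h₁.ne_s hu (h.inj_left (hi.trans h.map_s.symm))
    · exact G₁.ne ((h.eq_iff _ _).1 (h.map_s.trans hj.symm)).1
  not_z_adj w hw := by
    rcases h.adj_iff.1 hw with ⟨u, u', hu, hi, -⟩ | ⟨v, v', hv, hj, -⟩
    · exact G₂.ne.symm ((h.eq_iff _ _).1 (hi.trans h.map_z.symm)).2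
    · exact h₂.ne_z hv (h.inj_right (hj.trans h.map_z.symm))
  reach_of_adj w w' hw := by
    rw [← h.map_s]
    rcases h.adj_iff.1 hw with ⟨u, u', hu, rfl, -⟩ | ⟨v, v', hv, rfl, -⟩
    · exact h.reach_left (h₁.reach_of_adj _ _ hu)
    · exact h.reach h₁.reach_s_z (h₂.reach_of_adj _ _ hv)
  reach_z_of_adj w w' hw := by
    rw [← h.map_z]
    rcases h.adj_iff.1 hw with ⟨u, u', hu, -, rfl⟩ | ⟨v, v', hv, -, rfl⟩
    · exact h.reach (h₁.reach_z_of_adj _ _ hu) h₂.reach_s_z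
    · exact h.reach_right (h₂.reach_z_of_adj _ _ hv)
  reach_s_z := by
    rw [← h.map_s, ← h.map_z]
    exact h.reach h₁.reach_s_z h₂.reach_s_z

end IsSeq

/-- The precedence relation on edges, for edges enumerated by `φ`. -/
def Prec (G : SSG B) {X : Type} (φ : X → G.V × B × G.V) (x y : X) : Prop :=
  G.Reach (φ x).2.2 (φ y).1

/-- The edges of `G`, enumerated by a finite type and ordered by precedence, satisfy `Q`. -/
def Describes (G : SSG B) (Q : ∀ X : Type, (X → X → Prop) → (X → B) → Set X → Prop) : Prop :=
  G.Proper ∧ ∃ (X : Type) (_ : Fintype X) (φ : X → G.V × B × G.V),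
    G.E = Finset.univ.val.map φ ∧ Q X (G.Prec φ) (fun x => (φ x).2.1) Set.univ

/-- `Q` is preserved by embeddings of labeled relational structures. -/
def Stable (Q : ∀ X : Type, (X → X → Prop) → (X → B) → Set X → Prop) : Prop :=
  ∀ ⦃X Y : Type⦄ ⦃r : X → X → Prop⦄ ⦃r' : Y → Y → Prop⦄ ⦃lab : X → B⦄ ⦃lab' : Y → B⦄ ⦃f : X → Y⦄,
    f.Injective → (∀ x y, r' (f x) (f y) ↔ r x y) → (∀ x, lab' (f x) = lab x) →
      ∀ S, Q X r lab S → Q Y r' lab' (f '' S)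

theorem adj_of_edges {X : Type} [Fintype X] {φ : X → H.V × B × H.V}
    (h : H.E = Finset.univ.val.map φ) (x : X) : H.Adj (φ x).1 (φ x).2.2 :=
  ⟨(φ x).2.1, h ▸ Multiset.mem_map_of_mem φ (Finset.mem_univ x)⟩

theorem IsGlue.edges_sum {R : G₁.V → G₂.V → Prop} {i : G₁.V → H.V} {j : G₂.V → H.V}
    (h : IsGlue G₁ G₂ H R i j) {X₁ X₂ : Type} [Fintype X₁] [Fintype X₂]
    {φ₁ : X₁ → G₁.V × B × G₁.V} {φ₂ : X₂ → G₂.V × B × G₂.V}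
    (h₁ : G₁.E = Finset.univ.val.map φ₁) (h₂ : G₂.E = Finset.univ.val.map φ₂) :
    H.E = Finset.univ.val.map (Sum.elim (edgeMap i ∘ φ₁) (edgeMap j ∘ φ₂)) := by
  rw [h.edges, h₁, h₂, ← Finset.univ_disjSum_univ, Finset.val_disjSum, Multiset.disjSum,
    Multiset.map_add]
  simp only [Multiset.map_map, Function.comp_def, Sum.elim_inl, Sum.elim_inr]

variable {Q₁ Q₂ : ∀ X : Type, (X → X → Prop) → (X → B) → Set X → Prop}

theorem IsPar.describes {i : G₁.V → H.V} {j : G₂.V → H.V} (h : IsPar G₁ G₂ H i j)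
    (hG₁ : G₁.Describes Q₁) (hG₂ : G₂.Describes Q₂) (hQ₁ : Stable Q₁) (hQ₂ : Stable Q₂) :
    H.Describes fun X r lab S =>
      ∃ S₁ S₂, S = S₁ ∪ S₂ ∧ ParRel r S₁ S₂ ∧ Q₁ X r lab S₁ ∧ Q₂ X r lab S₂ := by
  obtain ⟨p₁, X₁, _, φ₁, hE₁, h₁⟩ := hG₁
  obtain ⟨p₂, X₂, _, φ₂, hE₂, h₂⟩ := hG₂
  have a₁ := adj_of_edges hE₁
  have a₂ := adj_of_edges hE₂
  refine ⟨h.proper p₁ p₂, X₁ ⊕ X₂, inferInstance, _, h.edges_sum hE₁ hE₂,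
    _, _, Set.range_inl_union_range_inr.symm, ⟨Set.isCompl_range_inl_range_inr.disjoint, ?_⟩, ?_, ?_⟩
  · rintro _ ⟨x, rfl⟩ _ ⟨y, rfl⟩
    exact ⟨h.not_reach p₁ p₂ (p₁.ne_s (a₁ x)) (p₂.ne_z (a₂ y)),
      h.symm.not_reach p₂ p₁ (p₂.ne_s (a₂ y)) (p₁.ne_z (a₁ x))⟩
  · rw [← Set.image_univ]
    exact hQ₁ Sum.inl_injective (fun x y => h.reach_left_iff p₁ p₂ (p₁.ne_s (a₁ x)))
      (fun _ => rfl) _ h₁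
  · rw [← Set.image_univ]
    exact hQ₂ Sum.inr_injective (fun x y => h.symm.reach_left_iff p₂ p₁ (p₂.ne_s (a₂ x)))
      (fun _ => rfl) _ h₂

theorem IsSeq.describes {i : G₁.V → H.V} {j : G₂.V → H.V} (h : IsSeq G₁ G₂ H i j)
    (hG₁ : G₁.Describes Q₁) (hG₂ : G₂.Describes Q₂) (hQ₁ : Stable Q₁) (hQ₂ : Stable Q₂) :
    H.Describes fun X r lab S =>
      ∃ S₁ S₂, S = S₁ ∪ S₂ ∧ SeqRel r S₁ S₂ ∧ Q₁ X r lab S₁ ∧ Q₂ X r lab S₂ := by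
  obtain ⟨p₁, X₁, _, φ₁, hE₁, h₁⟩ := hG₁
  obtain ⟨p₂, X₂, _, φ₂, hE₂, h₂⟩ := hG₂
  have a₁ := adj_of_edges hE₁
  have a₂ := adj_of_edges hE₂
  refine ⟨h.proper p₁ p₂, X₁ ⊕ X₂, inferInstance, _, h.edges_sum hE₁ hE₂,
    _, _, Set.range_inl_union_range_inr.symm, ⟨Set.isCompl_range_inl_range_inr.disjoint, ?_⟩, ?_, ?_⟩
  · rintro _ ⟨x, rfl⟩ _ ⟨y, rfl⟩
    exact ⟨h.reach (p₁.reach_z_of_adj _ _ (a₁ x)) (p₂.reach_of_adj _ _ (a₂ y)),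
      h.not_reach p₁ (p₁.ne_z (a₁ x))⟩
  · rw [← Set.image_univ]
    exact hQ₁ Sum.inl_injective (fun x y => h.reach_left_iff p₁ (p₁.ne_z (a₁ y)))
      (fun _ => rfl) _ h₁
  · rw [← Set.image_univ]
    exact hQ₂ Sum.inr_injective (fun x y => h.reach_right_iff p₁) (fun _ => rfl) _ h₂

theorem Describes.mono (h : H.Describes Q₁)
    (hQ : ∀ {X : Type} {r : X → X → Prop} {lab : X → B} {S : Set X}, Q₁ X r lab S → Q₂ X r lab S) :
    H.Describes Q₂ := by
  obtain ⟨p, X, _, φ, hE, h⟩ := h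
  exact ⟨p, X, _, φ, hE, hQ h⟩

theorem describes_atom {b : B} (h : (single b).Iso H) :
    H.Describes fun _ r lab => Realizes r lab (.atom b) := by
  obtain ⟨f, hE, hs, hz⟩ := h
  have hE' : H.E = {(H.s, b, H.z)} := by rw [← hE, ← hs, ← hz]; rfl
  have hadj : ∀ {u v}, H.Adj u v ↔ u = H.s ∧ v = H.z := by simp [Adj, hE']
  refine ⟨⟨?_, ?_, ?_, ?_, ?_⟩, Unit, inferInstance, fun _ => (H.s, b, H.z), by simp [hE'],
    (), rfl, by ext; simp⟩
  · exact fun u hu => H.ne (hadj.1 hu).2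
  · exact fun u hu => H.ne (hadj.1 hu).1.symm
  · exact fun u v hu => (hadj.1 hu).1 ▸ .refl
  · exact fun u v hu => (hadj.1 hu).2 ▸ .refl
  · exact .single (hadj.2 ⟨rfl, rfl⟩)

mutual
theorem describes_of_mem_sem : ∀ {t : SandTree B} {G : SSG B}, G ∈ sem t →
    G.Describes fun _ r lab => Realizes r lab t
  | .atom b, _, h => describes_atom (by simpa only [sem, Set.mem_ofPred_eq] using h)
  | .or ts, _, h => describes_of_mem_semOr (ts := ts) (by simpa only [sem] using h)
  | .and ts, _, h => describes_of_mem_semAnd (ts := ts) (by simpa only [sem] using h)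
  | .sand ts, _, h => describes_of_mem_semSand (ts := ts) (by simpa only [sem] using h)
theorem describes_of_mem_semOr : ∀ {ts : SandTreeList B} {G : SSG B}, G ∈ semOr ts →
    G.Describes fun _ r lab => RealizesOr r lab ts
  | .single t, _, h => describes_of_mem_sem (t := t) (by simpa only [semOr] using h)
  | .cons t ts, _, h => by
    rw [semOr] at h
    rcases h with h | h
    · exact (describes_of_mem_sem (t := t) h).mono fun h => Or.inl h
    · exact (describes_of_mem_semOr (ts := ts) h).mono fun h => Or.inr h
theorem describes_of_mem_semAnd : ∀ {ts : SandTreeList B} {G : SSG B}, G ∈ semAnd ts →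
    G.Describes fun _ r lab => RealizesAnd r lab ts
  | .single t, _, h => describes_of_mem_sem (t := t) (by simpa only [semAnd] using h)
  | .cons t ts, _, h => by
    rw [semAnd] at h
    obtain ⟨G₁, h₁, G₂, h₂, h⟩ := h
    obtain ⟨i, j, h⟩ := (isPar_par G₁ G₂).trans_iso h
    exact h.describes (describes_of_mem_sem (t := t) h₁) (describes_of_mem_semAnd (ts := ts) h₂)
      (fun _ _ _ _ _ _ _ hf hr hl _ => Realizes.image hf hr hl t)
      (fun _ _ _ _ _ _ _ hf hr hl _ => RealizesAnd.image hf hr hl ts)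
theorem describes_of_mem_semSand : ∀ {ts : SandTreeList B} {G : SSG B}, G ∈ semSand ts →
    G.Describes fun _ r lab => RealizesSand r lab ts
  | .single t, _, h => describes_of_mem_sem (t := t) (by simpa only [semSand] using h)
  | .cons t ts, _, h => by
    rw [semSand] at h
    obtain ⟨G₁, h₁, G₂, h₂, h⟩ := h
    obtain ⟨i, j, h⟩ := (isSeq_seq G₁ G₂).trans_iso h
    exact h.describes (describes_of_mem_sem (t := t) h₁) (describes_of_mem_semSand (ts := ts) h₂)
      (fun _ _ _ _ _ _ _ hf hr hl _ => Realizes.image hf hr hl t)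
      (fun _ _ _ _ _ _ _ hf hr hl _ => RealizesSand.image hf hr hl ts)
end

end SSG

theorem Multiset.exists_equiv_of_map_univ_eq {X Y α : Type} [Fintype X] [Fintype Y] {f : X → α}
    {g : Y → α} (h : Finset.univ.val.map f = Finset.univ.val.map g) :
    ∃ e : X ≃ Y, ∀ x, g (e x) = f x := by
  classical
  have hc : ∀ a, Fintype.card {x // f x = a} = Fintype.card {y // g y = a} := fun a => by
    have ha := congrArg (Multiset.count a) h
    rw [Multiset.count_map, Multiset.count_map] at ha
    simpa only [Fintype.card_subtype, Finset.card, Finset.filter_val, eq_comm] using ha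
  let e := (Equiv.sigmaFiberEquiv f).symm.trans
    ((Equiv.sigmaCongrRight fun a => Fintype.equivOfCardEq (hc a)).trans (Equiv.sigmaFiberEquiv g))
  exact ⟨e, fun x => (Fintype.equivOfCardEq (hc (f x)) ⟨x, rfl⟩).2⟩

/-- An SP graph is described by at most one `A`-term, up to commutativity. -/
theorem IsA.peq_of_mem_sem {B : Type} {a a' : SandTree B} {G : SSG B} (ha : IsA a) (ha' : IsA a')
    (h : G ∈ sem a) (h' : G ∈ sem a') : PEq a a' := by
  obtain ⟨-, X, _, φ, hE, hr⟩ := SSG.describes_of_mem_sem h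
  obtain ⟨-, X', _, φ', hE', hr'⟩ := SSG.describes_of_mem_sem h'
  obtain ⟨e, he⟩ := Multiset.exists_equiv_of_map_univ_eq (hE.symm.trans hE')
  refine determined _ _ a ha ha' (Realizes.image (f := e) e.injective (fun x y => ?_)
    (fun x => ?_) a hr) (by simpa using hr')
  · simp only [SSG.Prec, he]
  · rw [he]

section Existence

variable {B : Type}

theorem SandTreeList.toList_glue (l : List (SandTree B)) (ts : SandTreeList B) :
    (SandTreeList.glue l ts).toList = l ++ ts.toList := by
  induction l with
  | nil => rfl
  | cons t l ih => simp [SandTreeList.glue, SandTreeList.toList, ih]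

theorem SandTreeList.two_le_length_glue (ts us : SandTreeList B) :
    2 ≤ (SandTreeList.glue ts.toList us).toList.length := by
  rw [SandTreeList.toList_glue, List.length_append]
  have h₁ := List.length_pos_iff.2 ts.toList_ne_nil
  have h₂ := List.length_pos_iff.2 us.toList_ne_nil
  omega

theorem semAnd_glue : ∀ ts us : SandTreeList B, semAnd (SandTreeList.glue ts.toList us) =
    {G | ∃ G₁ ∈ semAnd ts, ∃ G₂ ∈ semAnd us, (G₁.par G₂).Iso G}
  | .single t, us => by simp only [SandTreeList.toList, SandTreeList.glue, semAnd]
  | .cons t ts, us => by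
    simp only [SandTreeList.toList, SandTreeList.glue, semAnd, semAnd_glue ts us]
    ext G
    constructor
    · rintro ⟨G₁, h₁, K, ⟨G₂, h₂, G₃, h₃, hK⟩, hG⟩
      exact ⟨_, ⟨G₁, h₁, G₂, h₂, .refl _⟩, G₃, h₃,
        (G₁.par_assoc G₂ G₃).trans (((SSG.Iso.refl _).par_congr hK).trans hG)⟩
    · rintro ⟨K, ⟨G₁, h₁, G₂, h₂, hK⟩, G₃, h₃, hG⟩
      exact ⟨G₁, h₁, _, ⟨G₂, h₂, G₃, h₃, .refl _⟩,
        (G₁.par_assoc G₂ G₃).symm.trans ((hK.par_congr (.refl _)).trans hG)⟩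

theorem semSand_glue : ∀ ts us : SandTreeList B, semSand (SandTreeList.glue ts.toList us) =
    {G | ∃ G₁ ∈ semSand ts, ∃ G₂ ∈ semSand us, (G₁.seq G₂).Iso G}
  | .single t, us => by simp only [SandTreeList.toList, SandTreeList.glue, semSand]
  | .cons t ts, us => by
    simp only [SandTreeList.toList, SandTreeList.glue, semSand, semSand_glue ts us]
    ext G
    constructor
    · rintro ⟨G₁, h₁, K, ⟨G₂, h₂, G₃, h₃, hK⟩, hG⟩
      exact ⟨_, ⟨G₁, h₁, G₂, h₂, .refl _⟩, G₃, h₃,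
        (G₁.seq_assoc G₂ G₃).trans (((SSG.Iso.refl _).seq_congr hK).trans hG)⟩
    · rintro ⟨K, ⟨G₁, h₁, G₂, h₂, hK⟩, G₃, h₃, hG⟩
      exact ⟨G₁, h₁, _, ⟨G₂, h₂, G₃, h₃, .refl _⟩,
        (G₁.seq_assoc G₂ G₃).symm.trans ((hK.seq_congr (.refl _)).trans hG)⟩

theorem IsA.exists_semAnd_eq {a : SandTree B} (h : IsA a) :
    ∃ ts : SandTreeList B, IsSL ts ∧ semAnd ts = sem a := by
  rcases h with (⟨b⟩ | ⟨-, h⟩) | h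
  · exact ⟨.single (.atom b), .single (.atom b), by rw [semAnd]⟩
  · exact ⟨_, h, by rw [sem]⟩
  · exact ⟨.single a, .single h, by rw [semAnd]⟩

theorem IsA.exists_semSand_eq {a : SandTree B} (h : IsA a) :
    ∃ ts : SandTreeList B, IsCL ts ∧ semSand ts = sem a := by
  rcases h with h | (⟨b⟩ | ⟨-, h⟩)
  · exact ⟨.single a, .single h, by rw [semSand]⟩
  · exact ⟨.single (.atom b), .single (.atom b), by rw [semSand]⟩
  · exact ⟨_, h, by rw [sem]⟩

theorem SSG.IsSP.exists_sem_eq {G : SSG B} (h : G.IsSP) :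
    ∃ a : SandTree B, IsA a ∧ sem a = {H | G.Iso H} := by
  induction h with
  | single b => exact ⟨.atom b, .inl (.atom b), by rw [sem]⟩
  | @seq G G' _ _ ih ih' =>
    obtain ⟨a, ha, hG⟩ := ih
    obtain ⟨a', ha', hG'⟩ := ih'
    obtain ⟨ts, hts, hsem⟩ := ha.exists_semSand_eq
    obtain ⟨us, hus, hsem'⟩ := ha'.exists_semSand_eq
    refine ⟨.sand (.glue ts.toList us), .inr (.sand (ts.two_le_length_glue us) ?_), ?_⟩
    · rw [isCL_iff] at hts hus ⊢
      simp only [SandTreeList.toList_glue, List.mem_append]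
      exact fun u hu => hu.elim (hts u) (hus u)
    · rw [sem, semSand_glue, hsem, hsem', hG, hG']
      ext H
      exact ⟨fun ⟨_, h₁, _, h₂, h⟩ => (h₁.seq_congr h₂).trans h,
        fun h => ⟨G, .refl _, G', .refl _, h⟩⟩
  | @par G G' _ _ ih ih' =>
    obtain ⟨a, ha, hG⟩ := ih
    obtain ⟨a', ha', hG'⟩ := ih'
    obtain ⟨ts, hts, hsem⟩ := ha.exists_semAnd_eq
    obtain ⟨us, hus, hsem'⟩ := ha'.exists_semAnd_eq
    refine ⟨.and (.glue ts.toList us), .inl (.and (ts.two_le_length_glue us) ?_), ?_⟩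
    · rw [isSL_iff] at hts hus ⊢
      simp only [SandTreeList.toList_glue, List.mem_append]
      exact fun u hu => hu.elim (hts u) (hus u)
    · rw [sem, semAnd_glue, hsem, hsem', hG, hG']
      ext H
      exact ⟨fun ⟨_, h₁, _, h₂, h⟩ => (h₁.par_congr h₂).trans h,
        fun h => ⟨G, .refl _, G', .refl _, h⟩⟩
  | iso _ hiso ih =>
    obtain ⟨a, ha, hG⟩ := ih
    refine ⟨a, ha, hG.trans ?_⟩
    ext H
    exact ⟨hiso.symm.trans, hiso.trans⟩

end Existence

/-- Every SP graph is the semantics of some `A`-term: for every SP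
graph `G` there is an `A`-term `a` with `⟦a⟧ = {G}`.  In particular every SP
graph has a decomposition into sequential and parallel compositions of
single-edge graphs, unique up to associativity (`A`-terms are fully flattened,
so uniqueness holds modulo commutativity of `AND`). -/
theorem semA_surjective (B : Type) (G : SSG B) (h : SSG.IsSP G) :
    ∃ a : SandTree B, IsA a ∧ sem a = {H | G.Iso H} ∧
      ∀ a' : SandTree B, IsA a' → sem a' = {H | G.Iso H} → PEq a a' := by
  obtain ⟨a, ha, hG⟩ := h.exists_sem_eq
  refine ⟨a, ha, hG, fun a' ha' hG' => ha.peq_of_mem_sem ha' (G := G) ?_ ?_⟩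
  · rw [hG]
    exact .refl G
  · rw [hG']
    exact .refl G
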